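/- arXiv:2602.13001 — 3 statements merged into one kernel-verified Lean document; each statement's English description precedes it below -/
import Mathlib

section
/- For any prime p ≥ 5 with p ≡ 3 (mod 4) and any odd positive integer r, ∑_{k=0}^{p^r−1} (8k+1) · (1/4)_k^3 (1/2)_k / ((1)_k^3 (3/4)_k) ≡ 3p^r − (27/4) p^{r+2} H^{(2)}_{(3p−1)/4} (mod p^{r+3}). -/
noncomputable section

/-- Pochhammer symbol `(x)_n = x(x+1)⋯(x+n-1)`. -/
def poch (x : ℚ) (n : ℕ) : ℚ := ∏ i ∈ Finset.range n, (x + i)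

/-- `n`-th harmonic number of order 2: `H_n^{(2)} = ∑_{k=1}^n 1/k^2`. -/
def H2 (n : ℕ) : ℚ := ∑ k ∈ Finset.Icc 1 n, (1 : ℚ) / (k : ℚ) ^ 2

/-- Least nonnegative residue of a rational `x` (with denominator coprime to `m`)
modulo `m`: the unique integer in `{0, …, m-1}` congruent to `x` mod `m`. -/
def res (m : ℕ) (x : ℚ) : ℕ := ((x.num : ZMod m) * (x.den : ZMod m)⁻¹).val

/-- Dwork's dash operation: `x* = (x + ⟨-x⟩_p)/p`. -/
def dash (p : ℕ) (x : ℚ) : ℚ := (x + (res p (-x) : ℚ)) / p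

/-- `r`-fold iterate of Dwork's dash operation, with `x^{*_0} = x`. -/
def dashIter (p r : ℕ) (x : ℚ) : ℚ := (dash p)^[r] x

/-- For rationals `u, v`, `u ≡ v (mod p^m)` means `u = v` or the `p`-adic
valuation of `u - v` is at least `m`. -/
def ratCongr (p : ℕ) (m : ℤ) (u v : ℚ) : Prop :=
  u = v ∨ m ≤ padicValRat p (u - v)


lemma poch_zero (x : ℚ) : poch x 0 = 1 := by simp [poch]

lemma poch_succ (x : ℚ) (n : ℕ) : poch x (n+1) = poch x n * (x + n) := by
  simp [poch, Finset.prod_range_succ]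

lemma poch_shift (x : ℚ) (n : ℕ) : poch (x+1) n * x = poch x n * (x + n) := by
  induction n with
  | zero => simp [poch_zero]
  | succ n ih =>
    rw [poch_succ, poch_succ]
    push_cast
    linear_combination (x + 1 + n) * ih

lemma poch_ne (x : ℚ) (n : ℕ) (h : ∀ i : ℕ, x + i ≠ 0) : poch x n ≠ 0 := by
  unfold poch
  exact Finset.prod_ne_zero_iff.mpr fun i _ => h i

lemma poch_neg (n k : ℕ) (h : n < k) : poch (-(n:ℚ)) k = 0 := by
  unfold poch
  apply Finset.prod_eq_zero (Finset.mem_range.mpr h)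
  ring

lemma ne_of4 (x : ℚ) (z : ℤ) (h : 4 * x = z) (hz : z ≠ 0) : x ≠ 0 := by
  rintro rfl
  apply hz
  have : (z:ℚ) = 0 := by rw [← h]; ring
  exact_mod_cast this

/-- summand with parameter -/
def TT (x : ℚ) (k : ℕ) : ℚ :=
  (8 * (k:ℚ) + 1) * (poch (1/4) k * poch (1/2) k * poch (1/4 - x) k * poch (1/4 + x) k) /
    (poch 1 k * poch (3/4) k * poch (1 + x) k * poch (1 - x) k)

def EE (n k : ℕ) : ℚ :=
  poch (1/4) k * poch (1/2) k * poch (-(n:ℚ)-1) k * poch ((n:ℚ)+1/2) k /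
    (poch 1 k * poch (3/4) k * poch ((n:ℚ)+5/4) k * poch (3/4-(n:ℚ)) k)

lemma TT_eq_EE (n k : ℕ) :
    TT ((n:ℚ)+1/4) k = (8*(k:ℚ)+1) * EE n k * (((n:ℚ)+1-k)/((n:ℚ)+1)) := by
  unfold TT EE
  have h1 : poch (1/4 - ((n:ℚ)+1/4)) k = poch (-(n:ℚ)-1) k * (((n:ℚ)+1-k)/((n:ℚ)+1)) := by
    have := poch_shift (-(n:ℚ)-1) k
    have hn : (n:ℚ)+1 ≠ 0 := by positivity
    rw [show (1/4 - ((n:ℚ)+1/4)) = -(n:ℚ)-1+1 by ring]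
    field_simp
    linear_combination -this
  rw [h1, show (1/4 + ((n:ℚ)+1/4)) = n + 1/2 by ring, show (1 + ((n:ℚ)+1/4)) = n + 5/4 by ring,
    show (1 - ((n:ℚ)+1/4)) = 3/4 - n by ring]
  ring

lemma TT_succ_eq_EE (n k : ℕ) :
    TT (((n+1:ℕ):ℚ)+1/4) k = (8*(k:ℚ)+1) * EE n k *
      (((n:ℚ)+1/2+k)/((n:ℚ)+1/2) * (((n:ℚ)+5/4)/((n:ℚ)+5/4+k)) * (((n:ℚ)+1/4-k)/((n:ℚ)+1/4))) := by
  unfold TT EE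
  have e1 : (1/4 - (((n+1:ℕ):ℚ)+1/4)) = -(n:ℚ)-1 := by push_cast; ring
  have e2 : poch (1/4 + (((n+1:ℕ):ℚ)+1/4)) k = poch ((n:ℚ)+1/2) k * (((n:ℚ)+1/2+k)/((n:ℚ)+1/2)) := by
    have := poch_shift ((n:ℚ)+1/2) k
    have hn : (n:ℚ)+1/2 ≠ 0 := by positivity
    rw [show (1/4 + (((n+1:ℕ):ℚ)+1/4)) = (n:ℚ)+1/2+1 by push_cast; ring, ← mul_div_assoc, ← this]
    field_simp
  have e3 : poch (1 + (((n+1:ℕ):ℚ)+1/4)) k = poch ((n:ℚ)+5/4) k * (((n:ℚ)+5/4+k)/((n:ℚ)+5/4)) := by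
    have := poch_shift ((n:ℚ)+5/4) k
    have hn : (n:ℚ)+5/4 ≠ 0 := by positivity
    rw [show (1 + (((n+1:ℕ):ℚ)+1/4)) = (n:ℚ)+5/4+1 by push_cast; ring, ← mul_div_assoc, ← this]
    field_simp
  have e4 : poch (1 - (((n+1:ℕ):ℚ)+1/4)) k * ((n:ℚ)+1/4-k) = poch (3/4-(n:ℚ)) k * ((n:ℚ)+1/4) := by
    have := poch_shift (-1/4-(n:ℚ)) k
    rw [show (1 - (((n+1:ℕ):ℚ)+1/4)) = -1/4-(n:ℚ) by push_cast; ring,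
      show 3/4-(n:ℚ) = -1/4-n+1 by ring]
    linear_combination this
  have e5 : poch (1 - (((n+1:ℕ):ℚ)+1/4)) k ≠ 0 := by
    apply poch_ne
    intro i
    exact ne_of4 _ (-1-4*n+4*i) (by push_cast; ring) (by omega)
  have e6 : poch (3/4-(n:ℚ)) k ≠ 0 := by
    apply poch_ne
    intro i
    exact ne_of4 _ (3-4*n+4*i) (by push_cast; ring) (by omega)
  have e7 : (n:ℚ)+1/4-k ≠ 0 := ne_of4 _ (4*n+1-4*k) (by push_cast; ring) (by omega)
  have e8 : (n:ℚ)+1/4 ≠ 0 := by positivity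
  have e9 : poch (1 - (((n+1:ℕ):ℚ)+1/4)) k = poch (3/4-(n:ℚ)) k * (((n:ℚ)+1/4) / ((n:ℚ)+1/4-k)) := by
    rw [← mul_div_assoc, ← e4, mul_div_cancel_right₀ _ e7]
  rw [e1, e2, e3, e9]
  simp only [div_eq_mul_inv, mul_inv_rev, inv_inv]
  ring

lemma EE_succ (n k : ℕ) : EE n (k+1) = EE n k *
    ((1/4+k)*(1/2+k)*(-(n:ℚ)-1+k)*((n:ℚ)+1/2+k) /
      ((1+k)*(3/4+k)*((n:ℚ)+5/4+k)*(3/4-(n:ℚ)+k))) := by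
  unfold EE
  simp only [poch_succ, div_eq_mul_inv, mul_inv_rev]
  ring

lemma wz (n K : ℕ) :
    ∑ k ∈ Finset.range K, (TT (((n+1:ℕ):ℚ)+1/4) k / (4*n+5) - TT ((n:ℚ)+1/4) k / (4*n+1)) =
    8/((4*(n:ℚ)+1)*((n:ℚ)+1/2)) * (K*((K:ℚ)-1/4)*((K:ℚ)-1/4-n)) * EE n K / ((n:ℚ)+1) := by
  induction K with
  | zero => simp
  | succ k ih =>
    rw [Finset.sum_range_succ, ih, TT_succ_eq_EE, TT_eq_EE, EE_succ]
    have e7 : (3/4-(n:ℚ)+k) ≠ 0 := ne_of4 _ (3-4*n+4*k) (by push_cast; ring) (by omega)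
    have h1 : (n:ℚ)+1/4 ≠ 0 := by positivity
    have h2 : (n:ℚ)+1/2 ≠ 0 := by positivity
    have h3 : (n:ℚ)+5/4+k ≠ 0 := by positivity
    have h4 : (n:ℚ)+1 ≠ 0 := by positivity
    have h5 : 1+(k:ℚ) ≠ 0 := by positivity
    have h6 : 3/4+(k:ℚ) ≠ 0 := by positivity
    have h7 : 4*(n:ℚ)+1 ≠ 0 := by positivity
    have h8 : 4*(n:ℚ)+5 ≠ 0 := by positivity
    have q1 : (n:ℚ)+1/4 = (4*n+1)/4 := by ring
    have q2 : (n:ℚ)+5/4 = (4*n+5)/4 := by ring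
    generalize EE n k = E
    push_cast
    have key : (8*(k:ℚ)+1) * (((n:ℚ)+1/2+k)/((n:ℚ)+1/2) * (((n:ℚ)+5/4)/((n:ℚ)+5/4+k)) * (((n:ℚ)+1/4-k)/((n:ℚ)+1/4))) / (4*n+5)
      - (8*(k:ℚ)+1) * (((n:ℚ)+1-k)/((n:ℚ)+1)) / (4*n+1)
      = 8/((4*(n:ℚ)+1)*((n:ℚ)+1/2)) * (((k:ℚ)+1)*((k:ℚ)+1-1/4)*((k:ℚ)+1-1/4-n)) * ((1/4+k)*(1/2+k)*(-(n:ℚ)-1+k)*((n:ℚ)+1/2+k) /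
      ((1+k)*(3/4+k)*((n:ℚ)+5/4+k)*(3/4-(n:ℚ)+k))) / ((n:ℚ)+1) - 8/((4*(n:ℚ)+1)*((n:ℚ)+1/2)) * (k*((k:ℚ)-1/4)*((k:ℚ)-1/4-n)) / ((n:ℚ)+1) := by
      have r1 : (((k:ℚ)+1)*((k:ℚ)+1-1/4)*((k:ℚ)+1-1/4-n)) * ((1/4+k)*(1/2+k)*(-(n:ℚ)-1+k)*((n:ℚ)+1/2+k) /
      ((1+k)*(3/4+k)*((n:ℚ)+5/4+k)*(3/4-(n:ℚ)+k))) = (1/4+k)*(1/2+k)*(-(n:ℚ)-1+k)*((n:ℚ)+1/2+k)/((n:ℚ)+5/4+k) := by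
        rw [← mul_div_assoc, div_eq_div_iff (by positivity) h3]
        ring
      rw [mul_assoc (8/((4*(n:ℚ)+1)*((n:ℚ)+1/2))), r1]
      have r2 : (((n:ℚ)+5/4)/((n:ℚ)+5/4+k)) / (4*n+5) = 1/(4*((n:ℚ)+5/4+k)) := by
        rw [q2]; field_simp
      have r3 : (((n:ℚ)+1/4-k)/((n:ℚ)+1/4)) = (4*n+1-4*k)/(4*n+1) := by
        rw [q1]; field_simp
      rw [r3]
      have r4 : ∀ a b c d : ℚ, a * (b * c * d) / (4*n+5) = a * b * d * (c / (4*n+5)) := by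
        intros; ring
      rw [r4, r2]
      generalize hA : (n:ℚ)+5/4+k = A at *
      generalize hB : (n:ℚ)+1/2 = B at *
      field_simp
      subst hA hB
      ring
    linear_combination E * key

lemma TT_zero (n k : ℕ) (h : n < k) : TT ((n:ℚ)+1/4) k = 0 := by
  unfold TT
  rw [show (1/4 - ((n:ℚ)+1/4)) = -(n:ℚ) by ring, poch_neg n k h]
  simp

lemma TT_sum (n : ℕ) : ∀ N, n < N → ∑ k ∈ Finset.range N, TT ((n:ℚ)+1/4) k = 4*n+1 := by
  have ext : ∀ n N : ℕ, n < N → ∑ k ∈ Finset.range N, TT ((n:ℚ)+1/4) k =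
      ∑ k ∈ Finset.range (n+1), TT ((n:ℚ)+1/4) k := by
    intro n N h
    symm
    apply Finset.sum_subset
    · intro i; simp; omega
    · intro i _ hi
      apply TT_zero
      simp at hi; omega
  induction n with
  | zero =>
    intro N h
    rw [ext _ _ h]
    simp [TT, poch_zero]
  | succ n ih =>
    intro N h
    rw [ext _ _ h]
    have := wz n (n+2)
    rw [Finset.sum_sub_distrib, ← Finset.sum_div, ← Finset.sum_div, ih (n+2) (by omega)] at this
    have h0 : EE n (n+2) = 0 := by
      unfold EE
      have := poch_neg (n+1) (n+2) (by omega)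
      rw [show (-(n:ℚ)-1) = -((n+1:ℕ):ℚ) by push_cast; ring, this]; simp
    rw [h0] at this
    have h7 : 4*(n:ℚ)+1 ≠ 0 := by positivity
    have h8 : 4*(n:ℚ)+5 ≠ 0 := by positivity
    rw [div_self h7, mul_zero, zero_div, sub_eq_zero, div_eq_iff h8] at this
    rw [this]; push_cast; ring

def QQ (x : ℚ) (k : ℕ) : ℚ :=
  poch (1/4 - x) k * poch (1/4 + x) k / (poch (1 + x) k * poch (1 - x) k)

/-- Saalschütz summand -/
def FF (x : ℚ) (k j : ℕ) : ℚ :=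
  poch (-(k:ℚ)) j * poch (1/4+k) j * poch (3/4) j / (poch 1 j * poch (1+x) j * poch (1-x) j)

def ff (x : ℚ) (k j : ℕ) : ℚ :=
  poch (-(k:ℚ)-1) j * poch (1/4+k) j * poch (3/4) j / (poch 1 j * poch (1+x) j * poch (1-x) j)

lemma FF_eq (x : ℚ) (k j : ℕ) : FF x k j = ff x k j * (((k:ℚ)+1-j)/((k:ℚ)+1)) := by
  unfold FF ff
  have h1 : poch (-(k:ℚ)) j = poch (-(k:ℚ)-1) j * (((k:ℚ)+1-j)/((k:ℚ)+1)) := by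
    have := poch_shift (-(k:ℚ)-1) j
    have hn : (k:ℚ)+1 ≠ 0 := by positivity
    rw [show -(k:ℚ) = -(k:ℚ)-1+1 by ring]
    field_simp
    rw [show -(k:ℚ)-1+1 = -(k:ℚ) by ring] at *
    linear_combination -this
  rw [h1]; ring

lemma FF_succ_eq (x : ℚ) (k j : ℕ) :
    FF x (k+1) j = ff x k j * ((1/4+(k:ℚ)+j)/(1/4+(k:ℚ))) := by
  unfold FF ff
  have h1 : poch (1/4+((k+1:ℕ):ℚ)) j = poch (1/4+(k:ℚ)) j * ((1/4+(k:ℚ)+j)/(1/4+(k:ℚ))) := by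
    have := poch_shift (1/4+(k:ℚ)) j
    have hn : 1/4+(k:ℚ) ≠ 0 := by positivity
    rw [← mul_div_assoc, ← this, mul_div_cancel_right₀ _ hn]
    congr 1; push_cast; ring
  rw [h1, show -((k+1:ℕ):ℚ) = -(k:ℚ)-1 by push_cast; ring]; ring

lemma ff_succ (x : ℚ) (k j : ℕ) :
    ff x k (j+1) = ff x k j * ((-(k:ℚ)-1+j)*(1/4+k+j)*(3/4+j)/((1+j)*(1+x+j)*(1-x+j))) := by
  unfold ff
  simp only [poch_succ, div_eq_mul_inv, mul_inv_rev]
  ring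

lemma saal_tel (x : ℚ) (hx1 : ∀ i : ℕ, 1 + x + i ≠ 0) (hx2 : ∀ i : ℕ, 1 - x + i ≠ 0) (k J : ℕ) :
    ∑ j ∈ Finset.range J, ((((k:ℚ)+1)^2-x^2) * FF x (k+1) j - (((k:ℚ)+1/4)^2-x^2) * FF x k j) =
      -(2*k+5/4)/((1/4+k)*(k+1)) * (J * ((J:ℚ)^2-x^2)) * ff x k J := by
  induction J with
  | zero => simp
  | succ j ih =>
    rw [Finset.sum_range_succ, ih, FF_succ_eq, FF_eq, ff_succ]
    have h1 := hx1 j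
    have h2 := hx2 j
    have h3 : 1/4+(k:ℚ) ≠ 0 := by positivity
    have h4 : (k:ℚ)+1 ≠ 0 := by positivity
    have h5 : 1+(j:ℚ) ≠ 0 := by positivity
    generalize ff x k j = E
    have r1 : (((j+1:ℕ):ℚ) * (((j+1:ℕ):ℚ)^2-x^2)) * ((-(k:ℚ)-1+j)*(1/4+k+j)*(3/4+j)/((1+j)*(1+x+j)*(1-x+j))) = (-(k:ℚ)-1+j)*(1/4+k+j)*(3/4+j) := by
      rw [← mul_div_assoc, div_eq_iff (by simp [h1, h2, h5])]
      push_cast; ring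
    have r2 : ∀ a b : ℚ, a * (((j+1:ℕ):ℚ) * (((j+1:ℕ):ℚ)^2-x^2)) * (E * b) = a * E * ((((j+1:ℕ):ℚ) * (((j+1:ℕ):ℚ)^2-x^2)) * b) := by
      intros; ring
    rw [r2, r1]
    generalize hA : 1/4+(k:ℚ) = A at *
    generalize hB : (k:ℚ)+1 = B at *
    field_simp
    subst hA hB
    ring

lemma saal (x : ℚ) (hx1 : ∀ i : ℕ, 1 + x + i ≠ 0) (hx2 : ∀ i : ℕ, 1 - x + i ≠ 0) (k : ℕ) :
    ∀ J, k < J → ∑ j ∈ Finset.range J, FF x k j = QQ x k := by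
  have ext : ∀ k J : ℕ, k < J → ∑ j ∈ Finset.range J, FF x k j =
      ∑ j ∈ Finset.range (k+1), FF x k j := by
    intro k J h
    symm
    apply Finset.sum_subset
    · intro i; simp; omega
    · intro i _ hi
      unfold FF
      rw [poch_neg k i (by simp at hi; omega)]
      simp
  induction k with
  | zero => intro J h; rw [ext _ _ h]; simp [FF, QQ, poch_zero]
  | succ k ih =>
    intro J h
    rw [ext _ _ h]
    have := saal_tel x hx1 hx2 k (k+2)
    rw [Finset.sum_sub_distrib, ← Finset.mul_sum, ← Finset.mul_sum, ih (k+2) (by omega)] at this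
    have h0 : ff x k (k+2) = 0 := by
      unfold ff
      rw [show (-(k:ℚ)-1) = -((k+1:ℕ):ℚ) by push_cast; ring, poch_neg (k+1) (k+2) (by omega)]; simp
    rw [h0, mul_zero, sub_eq_zero] at this
    have h1 := hx1 k
    have h2 := hx2 k
    have h3 : ((k:ℚ)+1)^2-x^2 ≠ 0 := by
      rw [show ((k:ℚ)+1)^2-x^2 = (1+x+k)*(1-x+k) by ring]; exact mul_ne_zero h1 h2
    apply mul_left_cancel₀ h3
    rw [this]
    unfold QQ
    rw [poch_succ, poch_succ, poch_succ, poch_succ]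
    have h4 := poch_ne _ k hx1
    have h5 := poch_ne _ k hx2
    field_simp
    ring

def CC (k : ℕ) : ℚ := (8 * (k:ℚ) + 1) * (poch (1/4) k * poch (1/2) k) / (poch 1 k * poch (3/4) k)

lemma TT_eq (x : ℚ) (k : ℕ) : TT x k = CC k * QQ x k := by
  unfold TT CC QQ
  simp only [div_eq_mul_inv, mul_inv_rev]
  ring

def KK (N : ℕ) : ℚ :=
  8 * N * ((N:ℚ) - 1/4) * (poch (1/4) N * poch (1/2) N / (poch 1 N * poch (3/4) N))

lemma gosper (j N : ℕ) :
    ∑ k ∈ Finset.range N, CC k * (poch (-(k:ℚ)) j * poch (1/4+k) j) =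
      KK N * (poch (1-N) j * poch (1/4+N) j) / (2*j+1) := by
  induction N with
  | zero => simp [KK]
  | succ N ih =>
    rw [Finset.sum_range_succ, ih]
    have a1 : poch (1-(N:ℚ)) j * N = poch (-(N:ℚ)) j * (N - j) := by
      have := poch_shift (-(N:ℚ)) j
      rw [show 1-(N:ℚ) = -(N:ℚ)+1 by ring]
      linear_combination -this
    have a2 : poch (1/4+((N+1:ℕ):ℚ)) j * (1/4+N) = poch (1/4+(N:ℚ)) j * (1/4+N+j) := by
      have := poch_shift (1/4+(N:ℚ)) j
      rw [show 1/4+((N+1:ℕ):ℚ) = 1/4+(N:ℚ)+1 by push_cast; ring]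
      exact this
    have a3 : poch (1 - ((N+1:ℕ):ℚ)) j = poch (-(N:ℚ)) j := by congr 1; push_cast; ring
    rw [a3]
    have b1 : KK N * (poch (1-(N:ℚ)) j * poch (1/4+(N:ℚ)) j) =
      8 * ((N:ℚ) - 1/4) * (poch (1/4) N * poch (1/2) N / (poch 1 N * poch (3/4) N)) * (poch (-(N:ℚ)) j * (N - j)) * poch (1/4+(N:ℚ)) j := by
      rw [← a1]; unfold KK; ring
    have b2 : KK (N+1) * (poch (-(N:ℚ)) j * poch (1/4+((N+1:ℕ):ℚ)) j) =
      8 * (1/2+N) * (poch (1/4) N * poch (1/2) N / (poch 1 N * poch (3/4) N)) * poch (-(N:ℚ)) j * (poch (1/4+(N:ℚ)) j * (1/4+N+j)) := by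
      rw [← a2]; unfold KK
      rw [poch_succ, poch_succ, poch_succ, poch_succ]
      have h1 : 1 + (N:ℚ) ≠ 0 := by positivity
      have h2 : 3/4 + (N:ℚ) ≠ 0 := by positivity
      have e : ((N+1:ℕ):ℚ) - 1/4 = 3/4+N := by push_cast; ring
      have e' : ((N+1:ℕ):ℚ) = 1+N := by push_cast; ring
      rw [e, e']
      generalize poch (1/4+(1+(N:ℚ))) j = Z
      generalize poch 1 N = P1
      generalize poch (3/4) N = P2
      simp only [div_eq_mul_inv, mul_inv_rev]
      have i1 : (1+(N:ℚ)) * (1+(N:ℚ))⁻¹ = 1 := mul_inv_cancel₀ h1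
      have i2 : (3/4+(N:ℚ)) * (3/4+(N:ℚ))⁻¹ = 1 := mul_inv_cancel₀ h2
      simp only [div_eq_mul_inv] at i2
      generalize (1+(N:ℚ))⁻¹ = I1 at *
      generalize (3*4⁻¹+(N:ℚ))⁻¹ = I2 at *
      generalize poch (1*4⁻¹) N = R1
      generalize poch (1*2⁻¹) N = R2
      generalize poch (-(N:ℚ)) j = R3
      have : ((1+(N:ℚ))*I1) * ((3*4⁻¹+(N:ℚ))*I2) = 1 := by rw [i1, i2]; ring
      linear_combination (8 * R1 * R2 * R3 * P1⁻¹ * P2⁻¹ * (1/4+N)*(1/2+N) * Z) * this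
    rw [b1, b2]
    unfold CC
    have h1 : 2*(j:ℚ)+1 ≠ 0 := by positivity
    rw [eq_div_iff h1, add_mul, div_mul_cancel₀ _ h1]
    ring

/-- the transformed sum -/
def UU (N : ℕ) (x : ℚ) : ℚ :=
  ∑ j ∈ Finset.range N, poch (3/4) j * poch (1/4+N) j * poch (1-N) j /
    ((2*j+1) * poch 1 j * poch (1+x) j * poch (1-x) j)

lemma whipple (N : ℕ) (x : ℚ) (hx1 : ∀ i : ℕ, 1 + x + i ≠ 0) (hx2 : ∀ i : ℕ, 1 - x + i ≠ 0) :
    ∑ k ∈ Finset.range N, TT x k = KK N * UU N x := by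
  have h1 : ∀ k ∈ Finset.range N, TT x k = ∑ j ∈ Finset.range N, CC k * FF x k j := by
    intro k hk
    rw [TT_eq, ← Finset.mul_sum, saal x hx1 hx2 k N (Finset.mem_range.mp hk)]
  rw [Finset.sum_congr rfl h1, Finset.sum_comm, UU, Finset.mul_sum]
  apply Finset.sum_congr rfl
  intro j _
  have := gosper j N
  have h2 : ∀ k ∈ Finset.range N, CC k * FF x k j = CC k * (poch (-(k:ℚ)) j * poch (1/4+k) j) *
     (poch (3/4) j / (poch 1 j * poch (1+x) j * poch (1-x) j)) := by
    intro k _; unfold FF; ring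
  rw [Finset.sum_congr rfl h2, ← Finset.sum_mul, this]
  simp only [div_eq_mul_inv, mul_inv_rev]
  ring

lemma main_ratio (N n : ℕ) (hn : 4*n+1 = 3*N) :
    (∑ k ∈ Finset.range N, TT 0 k) * UU N (3*N/4) = 3 * N * UU N 0 := by
  have hx : (3*(N:ℚ)/4) = n + 1/4 := by
    have : (4*(n:ℚ)+1) = 3*N := by exact_mod_cast hn
    rw [← this]; ring
  have h1 := whipple N (n+1/4) (fun i => by positivity)
    (fun i => ne_of4 _ (3-4*n+4*i) (by push_cast; ring) (by omega))
  have h0 := whipple N 0 (fun i => by positivity) (fun i => by rw [sub_zero]; positivity)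
  rw [TT_sum n N (by omega)] at h1
  rw [hx, h0]
  have : (4*(n:ℚ)+1) = 3*N := by exact_mod_cast hn
  rw [← this, h1]; ring

def Am (m k : ℕ) : ℤ := (-1)^k * (m.choose k) * ((m+k).choose k)
def Bm (m k : ℕ) : ℚ := (-1)^k * ((m+1).choose k) * ((m+k).choose k)

lemma Am_B1 (m k : ℕ) : ((m:ℚ)+1) * (Am m k : ℚ) = ((m:ℚ)+1-k) * Bm m k := by
  unfold Am Bm
  have h := Nat.choose_mul_succ_eq m k
  have h' : (m.choose k : ℚ) * (m+1) = ((m+1).choose k) * ((m:ℚ)+1-k) := by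
    rcases le_or_gt k (m+1) with hk | hk
    · have : (((m+1-k:ℕ)):ℚ) = (m:ℚ)+1-k := by rw [Nat.cast_sub hk]; push_cast; ring
      rw [← this]; exact_mod_cast h
    · rw [Nat.choose_eq_zero_of_lt hk, Nat.choose_eq_zero_of_lt (by omega : m < k)]; simp
  push_cast
  linear_combination (-1)^k * ((m+k).choose k : ℚ) * h'

lemma Am_B2 (m k : ℕ) : ((m:ℚ)+1) * (Am (m+1) k : ℚ) = ((m:ℚ)+1+k) * Bm m k := by
  unfold Am Bm
  have h := Nat.choose_mul_succ_eq (m+k) k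
  rw [show m + k + 1 - k = m + 1 by omega, show m + k + 1 = m + 1 + k by ring] at h
  have h' : ((m+k).choose k : ℚ) * (m+1+k) = ((m+1+k).choose k) * ((m:ℚ)+1) := by exact_mod_cast h
  push_cast
  linear_combination -(-1)^k * ((m+1).choose k : ℚ) * h'

lemma Am_rec (m k : ℕ) : (2*(m:ℚ)+3) * (Am (m+1) k) = (2*m+1) * Am m k + 2*(2*k+1) * Bm m k := by
  have h : (m:ℚ)+1 ≠ 0 := by positivity
  apply mul_left_cancel₀ h
  linear_combination (2*(m:ℚ)+3) * Am_B2 m k - (2*m+1) * Am_B1 m k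

lemma Bm_succ (m k : ℕ) : ((k:ℚ)+1)^2 * Bm m (k+1) = -((m+1-k)*(m+1+k)) * Bm m k := by
  unfold Bm
  have h1 := Nat.choose_succ_right_eq (m+1) k
  have h1' : ((m+1).choose (k+1) : ℚ) * (k+1) = ((m+1).choose k) * ((m:ℚ)+1-k) := by
    rcases le_or_gt k (m+1) with hk | hk
    · have : (((m+1-k:ℕ)):ℚ) = (m:ℚ)+1-k := by rw [Nat.cast_sub hk]; push_cast; ring
      rw [← this]; exact_mod_cast h1
    · rw [Nat.choose_eq_zero_of_lt hk, Nat.choose_eq_zero_of_lt (by omega : m+1 < k+1)]; simp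
  have h2 := Nat.add_one_mul_choose_eq (m+k) k
  have h2' : ((m:ℚ)+1+k) * ((m+k).choose k : ℚ) = ((m+(k+1)).choose (k+1) : ℚ) * (k+1) := by
    have : (((m+k+1):ℕ):ℚ) = (m:ℚ)+1+k := by push_cast; ring
    rw [← this]; exact_mod_cast h2
  rw [pow_succ]
  calc _ = -(-1)^k * (((m+1).choose (k+1) : ℚ) * (k+1)) * (((m+(k+1)).choose (k+1) : ℚ) * (k+1)) := by ring
    _ = _ := by rw [h1', ← h2']; ring

lemma Am_succ (m k : ℕ) : ((k:ℤ)+1)^2 * Am m (k+1) = -((m-k)*(m+1+k)) * Am m k := by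
  unfold Am
  have h1 := Nat.choose_succ_right_eq m k
  have h1' : (m.choose (k+1) : ℤ) * (k+1) = (m.choose k) * ((m:ℤ)-k) := by
    rcases le_or_gt k m with hk | hk
    · rw [← Nat.cast_sub hk]; exact_mod_cast h1
    · rw [Nat.choose_eq_zero_of_lt hk, Nat.choose_eq_zero_of_lt (by omega : m < k+1)]; simp
  have h2 := Nat.add_one_mul_choose_eq (m+k) k
  have h2' : ((m:ℤ)+1+k) * ((m+k).choose k : ℤ) = ((m+(k+1)).choose (k+1) : ℤ) * (k+1) := by
    have : (((m+k+1):ℕ):ℤ) = (m:ℤ)+1+k := by push_cast; ring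
    rw [← this]; exact_mod_cast h2
  rw [pow_succ (-1:ℤ)]
  calc _ = -(-1)^k * ((m.choose (k+1) : ℤ) * (k+1)) * (((m+(k+1)).choose (k+1) : ℤ) * (k+1)) := by ring
    _ = _ := by rw [h1', ← h2']; ring

lemma H2_zero : H2 0 = 0 := by simp [H2]
lemma H2_succ (k : ℕ) : H2 (k+1) = H2 k + 1/((k:ℚ)+1)^2 := by
  unfold H2
  rw [Finset.sum_Icc_succ_top (by omega)]; push_cast; ring

lemma Bm_sum (m K : ℕ) : ∑ k ∈ Finset.range K, Bm m k = -(K:ℚ)^2/((m:ℚ)+1)^2 * Bm m K := by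
  have hm : (m:ℚ)+1 ≠ 0 := by positivity
  induction K with
  | zero => simp
  | succ k ih =>
    rw [Finset.sum_range_succ, ih]
    have := Bm_succ m k
    push_cast
    field_simp
    linear_combination this

lemma BmH_sum (m K : ℕ) : ∑ k ∈ Finset.range K, Bm m k * H2 k =
    H2 K * (-(K:ℚ)^2/((m:ℚ)+1)^2 * Bm m K) +
      (1/((m:ℚ)+1)^2) * ((-((K:ℚ)+1)^2/((m:ℚ)+1)^2 * Bm m (K+1)) - 1) := by
  have hm : (m:ℚ)+1 ≠ 0 := by positivity
  induction K with
  | zero =>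
    have := Bm_succ m 0
    have h0 : Bm m 0 = 1 := by simp [Bm]
    simp only [Nat.cast_zero, zero_add] at this ⊢
    rw [h0] at this
    rw [Finset.sum_range_zero, H2_zero]
    field_simp
    linear_combination this
  | succ k ih =>
    rw [Finset.sum_range_succ, ih, H2_succ]
    have h1 := Bm_succ m k
    have h2 := Bm_succ m (k+1)
    have hk : (k:ℚ)+1 ≠ 0 := by positivity
    push_cast at *
    have e1 : Bm m (k+1) = -((m+1-k)*(m+1+k)) * Bm m k / ((k:ℚ)+1)^2 := by
      rw [eq_div_iff (by positivity), ← h1]; ring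
    have e2 : Bm m (k+1+1) = -((m+1-((k:ℚ)+1))*(m+1+((k:ℚ)+1))) * Bm m (k+1) / ((k:ℚ)+1+1)^2 := by
      rw [eq_div_iff (by positivity), ← h2]; ring
    have hk2 : (k:ℚ)+1+1 ≠ 0 := by positivity
    rw [e2, e1]
    field_simp
    ring

lemma Bm_big (m k : ℕ) (h : m + 1 < k) : Bm m k = 0 := by
  simp [Bm, Nat.choose_eq_zero_of_lt h]

lemma Am_sum1 (m : ℕ) : ∑ k ∈ Finset.range (m+1), (Am m k : ℚ) / (2*k+1) = 1/(2*m+1) := by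
  induction m with
  | zero => simp [Am]
  | succ m ih =>
    have h0 : ∑ k ∈ Finset.range (m+2), (Am m k : ℚ) / (2*k+1) = 1/(2*m+1) := by
      rw [Finset.sum_range_succ, ih]; simp [Am]
    have hB := Bm_sum m (m+2)
    rw [Bm_big m (m+2) (by omega), mul_zero] at hB
    have h3 : (2*(m:ℚ)+3) ≠ 0 := by positivity
    have h4 : (2*(m:ℚ)+1) ≠ 0 := by positivity
    have key : (2*(m:ℚ)+3) * ∑ k ∈ Finset.range (m+2), (Am (m+1) k : ℚ) / (2*k+1) =
        (2*(m:ℚ)+1) * ∑ k ∈ Finset.range (m+2), (Am m k : ℚ) / (2*k+1) +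
          2 * ∑ k ∈ Finset.range (m+2), Bm m k := by
      simp only [Finset.mul_sum, ← Finset.sum_add_distrib]
      apply Finset.sum_congr rfl
      intro k _
      have := Am_rec m k
      have h5 : (2*(k:ℚ)+1) ≠ 0 := by positivity
      field_simp
      linear_combination this
    rw [h0, hB, mul_one_div_cancel h4] at key
    push_cast
    rw [eq_div_iff (by positivity)]
    linear_combination key

lemma Am_sum2 (m : ℕ) : ∑ k ∈ Finset.range (m+1), (Am m k : ℚ) / (2*k+1) * H2 k = -2 * H2 m/(2*m+1) := by
  induction m with
  | zero => simp [Am, H2_zero]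
  | succ m ih =>
    have h0 : ∑ k ∈ Finset.range (m+2), (Am m k : ℚ) / (2*k+1) * H2 k = -2 * H2 m/(2*m+1) := by
      rw [Finset.sum_range_succ, ih]; simp [Am]
    have hB := BmH_sum m (m+2)
    rw [Bm_big m (m+2) (by omega), Bm_big m (m+2+1) (by omega), mul_zero, mul_zero, mul_zero] at hB
    have h3 : (2*(m:ℚ)+3) ≠ 0 := by positivity
    have h4 : (2*(m:ℚ)+1) ≠ 0 := by positivity
    have key : (2*(m:ℚ)+3) * ∑ k ∈ Finset.range (m+2), (Am (m+1) k : ℚ) / (2*k+1) * H2 k =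
        (2*(m:ℚ)+1) * ∑ k ∈ Finset.range (m+2), (Am m k : ℚ) / (2*k+1) * H2 k +
          2 * ∑ k ∈ Finset.range (m+2), Bm m k * H2 k := by
      simp only [Finset.mul_sum, ← Finset.sum_add_distrib]
      apply Finset.sum_congr rfl
      intro k _
      have := Am_rec m k
      have h5 : (2*(k:ℚ)+1) ≠ 0 := by positivity
      field_simp
      linear_combination H2 k * this
    rw [h0, hB, mul_div_cancel₀ _ h4] at key
    rw [H2_succ]
    push_cast
    rw [eq_div_iff (by positivity)]
    linear_combination key

lemma cB_rec (l : ℕ) : 16 * 4 * ((l:ℤ)+1)^2 * ((Nat.centralBinom (2*(l+1)) : ℤ) * Nat.centralBinom (l+1)) =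
    64 * 4 * ((4*l+1)*(4*l+3)) * ((Nat.centralBinom (2*l) : ℤ) * Nat.centralBinom l) := by
  have h1 : ((l:ℤ)+1) * Nat.centralBinom (l+1) = 2*(2*l+1) * Nat.centralBinom l := by
    exact_mod_cast Nat.succ_mul_centralBinom_succ l
  have h2 : (2*(l:ℤ)+1) * Nat.centralBinom (2*l+1) = 2*(2*(2*l)+1) * Nat.centralBinom (2*l) := by
    exact_mod_cast Nat.succ_mul_centralBinom_succ (2*l)
  have h3 : (2*(l:ℤ)+1+1) * Nat.centralBinom (2*(l+1)) = 2*(2*(2*l+1)+1) * Nat.centralBinom (2*l+1) := by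
    exact_mod_cast Nat.succ_mul_centralBinom_succ (2*l+1)
  have h : (2*(l:ℤ)+1) ≠ 0 := by positivity
  apply mul_left_cancel₀ h
  generalize (Nat.centralBinom (2*(l+1)) : ℤ) = a at *
  generalize (Nat.centralBinom (l+1) : ℤ) = b at *
  generalize (Nat.centralBinom (2*l+1) : ℤ) = c at *
  generalize (Nat.centralBinom (2*l) : ℤ) = d at *
  generalize (Nat.centralBinom l : ℤ) = e at *
  linear_combination (2*(l:ℤ)+1) * 32 * (2*l+2)*a*h1 + (2*(l:ℤ)+1)*32*(2*(2*l+1)*e)*h3 + 32*(2*(2*l+1)*e)*2*(2*(2*l+1)+1)*h2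


/-- `x` is `p`-integral with residue `z` -/
def RR (p : ℕ) (x : ℚ) (z : ZMod p) : Prop :=
  ∃ a b : ℤ, (b : ZMod p) ≠ 0 ∧ x * b = a ∧ (a : ZMod p) = z * b

section
variable {p : ℕ} [Fact p.Prime]

lemma RR_int (a : ℤ) : RR p a a := ⟨a, 1, by simp, by simp, by simp⟩
lemma RR_nat (a : ℕ) : RR p a a := by simpa using RR_int (p := p) a
lemma RR_zero : RR p 0 0 := by simpa using RR_int (p := p) 0
lemma RR_one : RR p 1 1 := by simpa using RR_int (p := p) 1
lemma RR_add {x y : ℚ} {z t : ZMod p} (h : RR p x z) (h' : RR p y t) : RR p (x+y) (z+t) := by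
  obtain ⟨a, b, hb, h1, h2⟩ := h
  obtain ⟨c, d, hd, h3, h4⟩ := h'
  refine ⟨a*d+c*b, b*d, by push_cast; exact mul_ne_zero hb hd, ?_, ?_⟩
  · push_cast; rw [← h1, ← h3]; ring
  · push_cast; rw [h2, h4]; ring
lemma RR_mul {x y : ℚ} {z t : ZMod p} (h : RR p x z) (h' : RR p y t) : RR p (x*y) (z*t) := by
  obtain ⟨a, b, hb, h1, h2⟩ := h
  obtain ⟨c, d, hd, h3, h4⟩ := h'
  refine ⟨a*c, b*d, by push_cast; exact mul_ne_zero hb hd, ?_, ?_⟩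
  · push_cast; rw [← h1, ← h3]; ring
  · push_cast; rw [h2, h4]; ring
lemma RR_neg {x : ℚ} {z : ZMod p} (h : RR p x z) : RR p (-x) (-z) := by
  have := RR_mul (RR_int (p := p) (-1)) h
  simpa using this
lemma RR_sub {x y : ℚ} {z t : ZMod p} (h : RR p x z) (h' : RR p y t) : RR p (x-y) (z-t) := by
  rw [sub_eq_add_neg, sub_eq_add_neg]; exact RR_add h (RR_neg h')
lemma RR_ne {x : ℚ} {z : ZMod p} (h : RR p x z) (hz : z ≠ 0) : x ≠ 0 := by
  rintro rfl
  obtain ⟨a, b, hb, h1, h2⟩ := h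
  have : a = 0 := by rw [zero_mul] at h1; exact_mod_cast h1.symm
  subst this
  rw [Int.cast_zero] at h2
  exact mul_ne_zero hz hb h2.symm
lemma RR_inv {x : ℚ} {z : ZMod p} (h : RR p x z) (hz : z ≠ 0) : RR p x⁻¹ z⁻¹ := by
  have hx := RR_ne h hz
  obtain ⟨a, b, hb, h1, h2⟩ := h
  refine ⟨b, a, by rw [h2]; exact mul_ne_zero hz hb, ?_, ?_⟩
  · rw [← h1]; field_simp
  · rw [h2]; field_simp
lemma RR_div {x y : ℚ} {z t : ZMod p} (h : RR p x z) (h' : RR p y t) (ht : t ≠ 0) : RR p (x/y) (z/t) := by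
  rw [div_eq_mul_inv, div_eq_mul_inv]; exact RR_mul h (RR_inv h' ht)
lemma RR_pow {x : ℚ} {z : ZMod p} (h : RR p x z) (n : ℕ) : RR p (x^n) (z^n) := by
  induction n with
  | zero => simpa using RR_one
  | succ n ih => rw [pow_succ, pow_succ]; exact RR_mul ih h
lemma RR_sum {ι : Type*} (s : Finset ι) (f : ι → ℚ) (g : ι → ZMod p) (h : ∀ i ∈ s, RR p (f i) (g i)) :
    RR p (∑ i ∈ s, f i) (∑ i ∈ s, g i) := by
  classical
  induction s using Finset.induction_on with
  | empty => simpa using RR_zero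
  | insert a s ha ih =>
    rw [Finset.sum_insert ha, Finset.sum_insert ha]
    exact RR_add (h a (by simp)) (ih fun i hi => h i (by simp [hi]))
lemma RR_unique {x : ℚ} {z t : ZMod p} (h : RR p x z) (h' : RR p x t) : z = t := by
  by_contra hne
  have := RR_ne (RR_sub h h') (sub_ne_zero.mpr hne)
  simp at this
lemma RR_dvd {x : ℚ} (h : RR p x 0) : ∃ y z, x = p * y ∧ RR p y z := by
  obtain ⟨a, b, hb, h1, h2⟩ := h
  rw [zero_mul, ZMod.intCast_zmod_eq_zero_iff_dvd] at h2
  obtain ⟨c, rfl⟩ := h2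
  have hb' : (b:ℚ) ≠ 0 := by
    rintro h
    have : b = 0 := by exact_mod_cast h
    subst this; simp at hb
  have hy := RR_div (RR_int (p := p) c) (RR_int b) hb
  refine ⟨_, _, ?_, hy⟩
  push_cast at h1
  rw [← mul_div_assoc, ← h1]; field_simp
lemma RR_val {y : ℚ} {z : ZMod p} (h : RR p y z) (hy : y ≠ 0) : 0 ≤ padicValRat p y := by
  obtain ⟨a, b, hb, h1, h2⟩ := h
  have hb' : (b:ℚ) ≠ 0 := by
    rintro h
    have : b = 0 := by exact_mod_cast h
    subst this; simp at hb
  have hb0 : padicValRat p (b:ℚ) = 0 := by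
    rw [padicValRat.of_int, padicValInt.eq_zero_of_not_dvd]; rfl
    rwa [← ZMod.intCast_zmod_eq_zero_iff_dvd]
  have := padicValRat.mul (p := p) hy hb'
  rw [h1, hb0, padicValRat.of_int] at this
  have h5 : (0:ℤ) ≤ (padicValInt p a : ℤ) := by positivity
  omega

lemma natne {k : ℕ} (h0 : 0 < k) (h : k < p) : (k : ZMod p) ≠ 0 := by
  rw [Ne, ZMod.natCast_eq_zero_iff]
  exact Nat.not_dvd_of_pos_of_lt h0 h

/-- harmonic numbers mod p -/
def hz (p : ℕ) (k : ℕ) : ZMod p := ∑ i ∈ Finset.range k, (((i:ZMod p)+1)^2)⁻¹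

lemma hz_succ (k : ℕ) : hz p (k+1) = hz p k + (((k:ZMod p)+1)^2)⁻¹ := by
  simp [hz, Finset.sum_range_succ]

lemma RR_H2 (k : ℕ) (h : k < p) : RR p (H2 k) (hz p k) := by
  induction k with
  | zero => simpa [H2_zero, hz] using RR_zero
  | succ k ih =>
    rw [H2_succ, hz_succ, one_div]
    apply RR_add (ih (by omega))
    have := natne (p := p) (k := k+1) (by omega) h
    push_cast at this
    apply RR_inv _ (pow_ne_zero _ this)
    apply RR_pow
    exact_mod_cast RR_nat (p := p) (k+1)

lemma hz_top (hp5 : 5 ≤ p) : hz p (p-1) = 0 := by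
  have h : ∑ x : (ZMod p)ˣ, ((x ^ 2 : (ZMod p)ˣ) : ZMod p) = 0 := by
    have := FiniteField.sum_pow_units (ZMod p) 2
    rw [ZMod.card, if_neg] at this
    · simpa using this
    · intro hd
      have := Nat.le_of_dvd (by norm_num) hd
      omega
  have h2 : ∑ x : (ZMod p)ˣ, ((x ^ 2 : (ZMod p)ˣ) : ZMod p)⁻¹ = 0 := by
    rw [← h]
    apply Fintype.sum_equiv (Equiv.inv _)
    intro x; simp
  rw [← h2]
  unfold hz
  symm
  have e : ∀ i : ℕ, i ∈ Finset.range (p-1) → ((i+1:ℕ):ZMod p) ≠ 0 := by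
    intro i hi
    simp at hi
    exact natne (by omega) (by omega)
  apply Finset.sum_bij' (i := fun (x : (ZMod p)ˣ) _ => (x:ZMod p).val - 1)
    (j := fun (i : ℕ) _ => if h : ((i+1:ℕ):ZMod p) ≠ 0 then (Units.mk0 _ h : (ZMod p)ˣ) else 1)
  · intro x _
    have h1 := ZMod.val_lt (x:ZMod p)
    have : (x:ZMod p).val ≠ 0 := by simp
    simp; omega
  · simp
  · intro x _
    have : (x:ZMod p).val ≠ 0 := by simp
    have h3 : (x:ZMod p).val - 1 + 1 = (x:ZMod p).val := by omega
    ext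
    simp [h3]
  · intro i hi
    rw [dif_pos (e i hi)]
    simp only [Units.val_mk0]
    rw [ZMod.val_natCast, Nat.mod_eq_of_lt]; omega
    simp at hi; omega
  · intro x _
    have : (x:ZMod p).val ≠ 0 := by simp
    have h3 : (x:ZMod p).val - 1 + 1 = (x:ZMod p).val := by omega
    have h4 : (((x:ZMod p).val - 1 : ℕ):ZMod p) + 1 = x := by
      have : ((((x:ZMod p).val - 1 + 1 : ℕ)):ZMod p) = x := by rw [h3]; simp
      rw [Nat.cast_add, Nat.cast_one] at this; exact this
    rw [h4]; push_cast; rfl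

lemma hz_refl (hp5 : 5 ≤ p) (k : ℕ) (h : k ≤ p - 1) : hz p (p-1-k) = - hz p k := by
  induction k with
  | zero => simp [hz_top hp5]; simp [hz]
  | succ k ih =>
    have := ih (by omega)
    rw [show p - 1 - k = (p - 1 - (k+1)) + 1 by omega, hz_succ] at this
    rw [hz_succ]
    have e : ((p - 1 - (k+1) : ℕ) : ZMod p) + 1 = -((k:ZMod p) + 1) := by
      have h1 : (p - 1 - (k+1)) + 1 + (k+1) = p := by omega
      have : (((p - 1 - (k+1)) + 1 + (k+1) : ℕ):ZMod p) = 0 := by rw [h1]; simp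
      push_cast at this
      linear_combination this
    rw [e, neg_sq] at this
    linear_combination this

end

section
variable {p : ℕ} [Fact p.Prime]

lemma lucas (a b c d : ℕ) (hb : b < p) (hd : d < p) :
    (((a*p+b).choose (c*p+d) : ℕ) : ZMod p) = (a.choose c) * (b.choose d) := by
  have h := Choose.choose_modEq_choose_mod_mul_choose_div_nat (p := p) (n := a*p+b) (k := c*p+d)
  rw [← ZMod.natCast_eq_natCast_iff] at h
  have hp : 0 < p := by omega
  have e1 : (a*p+b) % p = b := by rw [mul_comm, Nat.mul_add_mod, Nat.mod_eq_of_lt hb]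
  have e2 : (c*p+d) % p = d := by rw [mul_comm, Nat.mul_add_mod, Nat.mod_eq_of_lt hd]
  have e3 : (a*p+b) / p = a := by
    rw [mul_comm, Nat.mul_add_div hp, Nat.div_eq_of_lt hb, add_zero]
  have e4 : (c*p+d) / p = c := by
    rw [mul_comm, Nat.mul_add_div hp, Nat.div_eq_of_lt hd, add_zero]
  rw [e1, e2, e3, e4] at h
  rw [h]; push_cast; ring

/-- `catalan (2k) * centralBinom k / 64^k` mod `p` -/
def ww (p : ℕ) (k : ℕ) : ZMod p := (catalan (2*k) : ZMod p) * (Nat.centralBinom k) * ((64:ZMod p)⁻¹)^k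

lemma cat_eq (k : ℕ) : (catalan (2*k) : ℤ) = (4*k).choose (2*k) - (4*k).choose (2*k+1) := by
  have h1 : ((2*k:ℤ)+1) * catalan (2*k) = Nat.centralBinom (2*k) := by
    exact_mod_cast succ_mul_catalan_eq_centralBinom (2*k)
  have h2 := Nat.choose_succ_right_eq (4*k) (2*k)
  rw [show 4*k-2*k = 2*k by omega] at h2
  have h2' : ((4*k).choose (2*k+1) : ℤ) * (2*k+1) = (4*k).choose (2*k) * (2*k) := by exact_mod_cast h2
  have h : ((2*k:ℤ)+1) ≠ 0 := by positivity
  apply mul_left_cancel₀ h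
  rw [h1, Nat.centralBinom, show 2*(2*k) = 4*k by ring]
  linear_combination h2'

lemma ww_eq (k : ℕ) : ww p k = (((4*k).choose (2*k) : ℕ) - ((4*k).choose (2*k+1) : ℕ) : ZMod p) *
    ((2*k).choose k : ℕ) * ((64:ZMod p)⁻¹)^k := by
  unfold ww
  have := cat_eq k
  have h : (((catalan (2*k) : ℤ)) : ZMod p) = (((4*k).choose (2*k) - (4*k).choose (2*k+1) : ℤ) : ZMod p) := by rw [this]
  push_cast at h
  rw [h, Nat.centralBinom]

lemma p64 (hp5 : 5 ≤ p) : (64:ZMod p) ≠ 0 := by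
  have : (2:ZMod p) ≠ 0 := by exact_mod_cast natne (p := p) (k := 2) (by omega) (by omega)
  rw [show (64:ZMod p) = 2^6 by norm_num]
  exact pow_ne_zero _ this

lemma p64p (q l : ℕ) : ((64:ZMod p)⁻¹)^(q*p+l) = ((64:ZMod p)⁻¹)^q * ((64:ZMod p)⁻¹)^l := by
  rw [pow_add, pow_mul, ZMod.pow_card]

lemma ww_low (m : ℕ) (hm : p = 4*m+3) (q l : ℕ) (hl : l ≤ m) :
    ww p (q*p+l) = (((4*q).choose (2*q) : ℕ) : ZMod p) * ((2*q).choose q : ℕ) * ((64:ZMod p)⁻¹)^q * ww p l := by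
  rw [ww_eq, ww_eq, p64p]
  have e1 := lucas (p := p) (4*q) (4*l) (2*q) (2*l) (by omega) (by omega)
  have e2 := lucas (p := p) (4*q) (4*l) (2*q) (2*l+1) (by omega) (by omega)
  have e3 := lucas (p := p) (2*q) (2*l) q l (by omega) (by omega)
  rw [show 4*(q*p+l) = 4*q*p+4*l by ring, show 2*(q*p+l)+1 = 2*q*p+(2*l+1) by ring,
    show 2*(q*p+l) = 2*q*p+2*l by ring, e1, e2, e3]
  ring

lemma cb_zero (q l : ℕ) (h1 : p < 2*l) (h2 : l < p) : (((2*(q*p+l)).choose (q*p+l) : ℕ):ZMod p) = 0 := by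
  have e3 := lucas (p := p) (2*q+1) (2*l-p) q l (by omega) (by omega)
  rw [show 2*(q*p+l) = (2*q+1)*p+(2*l-p) by
    rw [add_mul, one_mul, mul_add, mul_assoc]; omega, e3,
    Nat.choose_eq_zero_of_lt (by omega : 2*l-p < l)]
  simp

lemma ww_mid (m : ℕ) (hm : p = 4*m+3) (q l : ℕ) (hl : m < l) (hl2 : l < p) (hne : l ≠ 2*m+1) :
    ww p (q*p+l) = 0 := by
  rw [ww_eq]
  rcases lt_or_gt_of_ne hne with h | h
  · have e1 := lucas (p := p) (4*q+1) (4*l-p) (2*q) (2*l) (by omega) (by omega)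
    have e2 := lucas (p := p) (4*q+1) (4*l-p) (2*q) (2*l+1) (by omega) (by omega)
    rw [show 4*(q*p+l) = (4*q+1)*p+(4*l-p) by
      rw [add_mul, one_mul, mul_add, mul_assoc]; omega, show 2*(q*p+l)+1 = 2*q*p+(2*l+1) by ring,
      show 2*(q*p+l) = 2*q*p+2*l by ring, e1, e2,
      Nat.choose_eq_zero_of_lt (by omega : 4*l-p < 2*l),
      Nat.choose_eq_zero_of_lt (by omega : 4*l-p < 2*l+1)]
    simp
  · rw [cb_zero q l (by omega) hl2]; simp

lemma choose_mid (m : ℕ) (hm : p = 4*m+3) : (((2*(2*m+1)).choose (2*m+1) : ℕ) : ZMod p) = -1 := by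
  have h : ∀ k, k < p → (((p-1).choose k : ℕ):ZMod p) = (-1)^k := by
    intro k hk
    induction k with
    | zero => simp
    | succ k ih =>
      have h1 := Nat.choose_succ_succ (p-1) k
      have h2 : (p-1).succ = p := by omega
      rw [h2] at h1
      have h3 : ((p.choose k.succ : ℕ):ZMod p) = 0 := by
        rw [ZMod.natCast_eq_zero_iff]
        exact (Fact.out : p.Prime).dvd_choose_self (by omega) (by omega)
      rw [h1] at h3
      push_cast at h3
      rw [ih (by omega)] at h3
      rw [pow_succ]
      linear_combination h3
  have := h (2*m+1) (by omega)
  rw [show p-1 = 2*(2*m+1) by omega] at this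
  rw [this, Odd.neg_one_pow ⟨m, rfl⟩]

lemma ww_half (m : ℕ) (hm : p = 4*m+3) (hp5 : 5 ≤ p) (q : ℕ) :
    ww p (q*p+(2*m+1)) = (((4*q+1).choose (2*q+1) : ℕ) : ZMod p) * ((2*q).choose q : ℕ) * ((64:ZMod p)⁻¹)^q := by
  rw [ww_eq, p64p]
  have e1 := lucas (p := p) (4*q+1) (p-2) (2*q) (4*m+2) (by omega) (by omega)
  have e2 := lucas (p := p) (4*q+1) (p-2) (2*q+1) 0 (by omega) (by omega)
  have e3 := lucas (p := p) (2*q) (2*(2*m+1)) q (2*m+1) (by omega) (by omega)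
  have e64 : ((64:ZMod p)⁻¹)^(2*m+1) = 1 := by
    have h8 : (8:ZMod p) ≠ 0 := by
      intro h
      apply p64 hp5
      rw [show (64:ZMod p) = 8*8 by norm_num, h]; ring
    rw [inv_pow, show (64:ZMod p) = 8^2 by norm_num, ← pow_mul,
      show 2*(2*m+1) = p-1 by omega, ZMod.pow_card_sub_one_eq_one h8, inv_one]
  rw [show 4*(q*p+(2*m+1)) = (4*q+1)*p+(p-2) by
      rw [add_mul, one_mul, mul_add, mul_assoc]; omega, show 2*(q*p+(2*m+1))+1 = (2*q+1)*p+0 by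
      rw [add_mul, one_mul, mul_add, mul_assoc]; omega,
      show 2*(q*p+(2*m+1)) = 2*q*p+(4*m+2) by ring, e1, e2, e64,
      Nat.choose_eq_zero_of_lt (by omega : p-2 < 4*m+2)]
  rw [show 2*q*p+(4*m+2) = 2*q*p+2*(2*m+1) by ring, e3, choose_mid m hm]
  simp

lemma ww_Am (m : ℕ) (hm : p = 4*m+3) (hp5 : 5 ≤ p) (l : ℕ) (hl : l ≤ m) :
    ww p l * (2*l+1) = (Am m l : ZMod p) := by
  have hc : ∀ l : ℕ, ww p l * (2*l+1) = (Nat.centralBinom (2*l) : ZMod p) * Nat.centralBinom l * ((64:ZMod p)⁻¹)^l := by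
    intro l
    have h1 : ((2*l:ZMod p)+1) * catalan (2*l) = Nat.centralBinom (2*l) := by
      exact_mod_cast congrArg (Nat.cast : ℕ → ZMod p) (succ_mul_catalan_eq_centralBinom (2*l))
    rw [← h1, ww]; ring
  rw [hc]
  induction l with
  | zero => simp [Am]
  | succ l ih =>
    have ih := ih (by omega)
    have a1 := congrArg (Int.cast : ℤ → ZMod p) (Am_succ m l)
    have a2 := congrArg (Int.cast : ℤ → ZMod p) (cB_rec l)
    have h2 : (2:ZMod p) ≠ 0 := by exact_mod_cast natne (p := p) (k := 2) (by omega) (by omega)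
    have hl1 : ((l:ZMod p)+1) ≠ 0 := by exact_mod_cast natne (p := p) (k := l+1) (by omega) (by omega)
    have h64 := p64 (p := p) hp5
    have hm0 : 4*(m:ZMod p)+3 = 0 := by
      have : ((4*m+3:ℕ):ZMod p) = 0 := by rw [← hm]; simp
      exact_mod_cast this
    push_cast at a1 a2
    have hne : (64:ZMod p) * ((l:ZMod p)+1)^2 ≠ 0 := mul_ne_zero h64 (pow_ne_zero _ hl1)
    apply mul_left_cancel₀ hne
    have h64' : (64:ZMod p) * (64:ZMod p)⁻¹ = 1 := mul_inv_cancel₀ h64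
    rw [pow_succ]
    generalize (64:ZMod p)⁻¹ = I at *
    generalize (Nat.centralBinom (2*(l+1)) : ZMod p) = a at *
    generalize (Nat.centralBinom (l+1) : ZMod p) = b at *
    generalize (Nat.centralBinom (2*l) : ZMod p) = d at *
    generalize (Nat.centralBinom l : ZMod p) = e at *
    generalize (Am m l : ZMod p) = X at *
    generalize (Am m (l+1) : ZMod p) = Y at *
    linear_combination (I^l*I)*a2 + 4*(4*l+1)*(4*l+3)*(d*e*I^l)*h64' + 4*(4*l+1)*(4*l+3)*ih - 64*a1 + X*4*(4*(m:ZMod p)+1)*hm0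

lemma RR_2k (m : ℕ) (hm : p = 4*m+3) (l : ℕ) (hl : l ≤ m) : RR p (2*l+1) (2*l+1) ∧ (2*(l:ZMod p)+1) ≠ 0 :=
  ⟨by exact_mod_cast RR_nat (p := p) (2*l+1),
   by exact_mod_cast natne (p := p) (k := 2*l+1) (by omega) (by omega)⟩

lemma RR_ww (m : ℕ) (hm : p = 4*m+3) (hp5 : 5 ≤ p) (l : ℕ) (hl : l ≤ m) :
    RR p ((Am m l : ℚ)/(2*l+1)) (ww p l) := by
  obtain ⟨h1, h2⟩ := RR_2k m hm l hl
  have := RR_div (RR_int (p := p) (Am m l)) h1 h2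
  rwa [← ww_Am m hm hp5 l hl, mul_div_cancel_right₀ _ h2] at this

lemma inv2m (m : ℕ) (hm : p = 4*m+3) : ((2*(m:ZMod p)+1))⁻¹ = -2 := by
  have hm0 : 4*(m:ZMod p)+3 = 0 := by
    have : ((4*m+3:ℕ):ZMod p) = 0 := by rw [← hm]; simp
    exact_mod_cast this
  apply inv_eq_of_mul_eq_one_right
  linear_combination -hm0

lemma ww_sum1 (m : ℕ) (hm : p = 4*m+3) (hp5 : 5 ≤ p) : ∑ l ∈ Finset.range (m+1), ww p l = -2 := by
  have h1 := RR_sum (p := p) (Finset.range (m+1)) (fun l => (Am m l : ℚ)/(2*l+1)) (fun l => ww p l)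
    (fun l hl => RR_ww m hm hp5 l (by simp at hl; omega))
  rw [Am_sum1] at h1
  obtain ⟨h2, h3⟩ := RR_2k m hm m le_rfl
  have h4 := RR_inv h2 h3
  rw [one_div] at h1
  rw [RR_unique h1 h4, inv2m m hm]

lemma ww_sum2 (m : ℕ) (hm : p = 4*m+3) (hp5 : 5 ≤ p) :
    ∑ l ∈ Finset.range (m+1), ww p l * hz p l = 4 * hz p m := by
  have h1 := RR_sum (p := p) (Finset.range (m+1)) (fun l => (Am m l : ℚ)/(2*l+1) * H2 l) (fun l => ww p l * hz p l)
    (fun l hl => by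
      simp at hl
      exact RR_mul (RR_ww m hm hp5 l (by omega)) (RR_H2 l (by omega)))
  rw [Am_sum2] at h1
  obtain ⟨h2, h3⟩ := RR_2k m hm m le_rfl
  have h4 := RR_div (RR_mul (RR_int (p := p) (-2)) (RR_H2 m (by omega))) h2 h3
  push_cast at h4
  rw [RR_unique h1 h4, div_eq_mul_inv, inv2m m hm]; ring

lemma sum_split (m : ℕ) (hm : p = 4*m+3) (f : ℕ → ZMod p)
    (h : ∀ l, m < l → l < p → l ≠ 2*m+1 → f l = 0) :
    ∑ l ∈ Finset.range p, f l = ∑ l ∈ Finset.range (m+1), f l + f (2*m+1) := by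
  have h1 : ∑ l ∈ Finset.range p, f l = ∑ l ∈ insert (2*m+1) (Finset.range (m+1)), f l := by
    symm
    apply Finset.sum_subset
    · intro i; simp; omega
    · intro i hi hi2
      simp at hi hi2
      exact h i (by omega) hi (by omega)
  by_cases hm0 : m = 0
  · subst hm0
    rw [h1, Finset.sum_insert (by simp)]; ring
  · rw [h1, Finset.sum_insert (by simp; omega)]; ring

lemma dwork (m : ℕ) (hm : p = 4*m+3) (hp5 : 5 ≤ p) (q : ℕ) :
    ∑ l ∈ Finset.range p, ww p (q*p+l) = - ww p q := by
  rw [sum_split m hm _ (fun l h1 h2 h3 => ww_mid m hm q l h1 h2 h3)]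
  rw [Finset.sum_congr rfl (fun l hl => ww_low m hm q l (by simp at hl; omega)), ← Finset.mul_sum,
    ww_sum1 m hm hp5, ww_half m hm hp5, ww_eq q, Nat.choose_succ_succ (4*q) (2*q)]
  push_cast
  simp only [Nat.succ_eq_add_one]
  ring

lemma sum_block (f : ℕ → ZMod p) (M P : ℕ) :
    ∑ k ∈ Finset.range (M*P), f k = ∑ q ∈ Finset.range M, ∑ l ∈ Finset.range P, f (q*P+l) := by
  induction M with
  | zero => simp
  | succ M ih =>
    rw [add_mul, one_mul, Finset.sum_range_add, ih, Finset.sum_range_succ]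

lemma dwork_iter (m : ℕ) (hm : p = 4*m+3) (hp5 : 5 ≤ p) (s q : ℕ) :
    ∑ l ∈ Finset.range (p^s), ww p (q*p^s+l) = (-1)^s * ww p q := by
  induction s with
  | zero => simp
  | succ s ih =>
    rw [pow_succ, sum_block]
    have : ∀ t ∈ Finset.range (p^s), ∑ l ∈ Finset.range p, ww p (q*(p^s*p)+(t*p+l)) = -ww p (q*p^s+t) := by
      intro t _
      rw [← dwork m hm hp5]
      apply Finset.sum_congr rfl
      intro l _
      congr 1; ring
    rw [Finset.sum_congr rfl this, Finset.sum_neg_distrib, ih]; ring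

lemma ww_zero : ww p 0 = 1 := by simp [ww]

lemma ww_total (m : ℕ) (hm : p = 4*m+3) (hp5 : 5 ≤ p) (r : ℕ) (hr : Odd r) :
    ∑ l ∈ Finset.range (p^r), ww p l = -1 := by
  have := dwork_iter m hm hp5 r 0
  simpa [ww_zero, hr.neg_one_pow] using this

lemma ww_top (r k : ℕ) (h1 : p^r < 2*k) (h2 : k < p^r) (hodd : Odd p) : (((2*k).choose k : ℕ):ZMod p) = 0 := by
  induction r generalizing k with
  | zero => rw [pow_zero] at h1 h2; omega
  | succ r ih =>
    have hp : 0 < p := (Fact.out : p.Prime).pos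
    have hk : k = (k/p)*p + k%p := by rw [mul_comm]; exact (Nat.div_add_mod k p).symm
    have hl := Nat.mod_lt k hp
    generalize k/p = q at *
    generalize k%p = l at *
    subst hk
    rcases lt_or_ge (2*l) p with h | h
    · have e3 := lucas (p := p) (2*q) (2*l) q l (by omega) (by omega)
      rw [show 2*(q*p+l) = 2*q*p+2*l by ring, e3, ih q]
      · simp
      · have h3 : Odd (p^r) := hodd.pow
        obtain ⟨t, ht⟩ := h3
        have : ¬ (2*q < p^r) := by
          intro hlt
          have : (2*q+1)*p ≤ p^r*p := Nat.mul_le_mul_right _ hlt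
          rw [pow_succ] at h1
          nlinarith
        omega
      · by_contra hge
        push Not at hge
        have : p^r*p ≤ q*p := Nat.mul_le_mul_right _ hge
        rw [pow_succ] at h2
        omega
    · apply cb_zero q l _ hl
      obtain ⟨t, ht⟩ := hodd
      omega

/-- the weighted sum -/
lemma ww_weighted (m : ℕ) (hm : p = 4*m+3) (hp5 : 5 ≤ p) (s : ℕ) (hs : Even s) :
    ∑ k ∈ Finset.range (p^(s+1)), ww p k * hz p (k / p^s) = -4 * hz p (3*m+2) := by
  have hp : 0 < p^s := pow_pos (by omega) _
  rw [pow_succ', sum_block]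
  have h1 : ∀ q ∈ Finset.range p, ∑ l ∈ Finset.range (p^s), ww p (q*p^s+l) * hz p ((q*p^s+l)/p^s) =
      ww p q * hz p q := by
    intro q _
    have : ∀ l ∈ Finset.range (p^s), ww p (q*p^s+l) * hz p ((q*p^s+l)/p^s) = ww p (q*p^s+l) * hz p q := by
      intro l hl
      rw [mul_comm q, Nat.mul_add_div hp, Nat.div_eq_of_lt (by simpa using hl), add_zero]
    rw [Finset.sum_congr rfl this, ← Finset.sum_mul, dwork_iter m hm hp5, hs.neg_one_pow, one_mul]
  rw [Finset.sum_congr rfl h1, sum_split m hm]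
  · rw [ww_sum2 m hm hp5]
    have h2 := hz_refl (p := p) hp5 m (by omega)
    rw [show p - 1 - m = 3*m+2 by omega] at h2
    have h3 := hz_refl (p := p) hp5 (2*m+1) (by omega)
    rw [show p - 1 - (2*m+1) = 2*m+1 by omega] at h3
    have h4 : (2:ZMod p) ≠ 0 := by exact_mod_cast natne (p := p) (k := 2) (by omega) (by omega)
    have h5 : hz p (2*m+1) = 0 := by
      apply (mul_eq_zero_iff_left h4).mp
      linear_combination h3
    rw [h2, h5]; ring
  · intro l h1 h2 h3
    have := ww_mid m hm 0 l h1 h2 h3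
    rw [zero_mul, zero_add] at this
    rw [this, zero_mul]

end

lemma base_poch (k : ℕ) : poch (3/4) k * poch (1/4) k * 64^k =
    (Nat.centralBinom (2*k) : ℚ) * Nat.centralBinom k * poch 1 k ^ 2 := by
  induction k with
  | zero => simp [poch_zero]
  | succ k ih =>
    have a2 := congrArg (Int.cast : ℤ → ℚ) (cB_rec k)
    push_cast at a2
    simp only [poch_succ, pow_succ]
    linear_combination (64 * (3/4+k)*(1/4+k)) * ih - (poch 1 k)^2/64 * a2

lemma poch1_ne (k : ℕ) : poch 1 k ≠ 0 := poch_ne _ _ (fun i => by positivity)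

section
variable {p : ℕ} [Fact p.Prime]

lemma RR_base (hp5 : 5 ≤ p) (k : ℕ) :
    RR p (poch (3/4) k * poch (1/4) k / (poch 1 k ^ 2 * (2*k+1))) (ww p k) := by
  have h1 : ((2*k:ℚ)+1) * catalan (2*k) = Nat.centralBinom (2*k) := by
    exact_mod_cast congrArg (Nat.cast : ℕ → ℚ) (succ_mul_catalan_eq_centralBinom (2*k))
  have hb := base_poch k
  have e : poch (3/4) k * poch (1/4) k / (poch 1 k ^ 2 * (2*k+1)) =
      (catalan (2*k) : ℚ) * (Nat.centralBinom k) * ((64:ℚ)⁻¹)^k := by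
    have h0 := poch1_ne k
    have h2 : (2*k:ℚ)+1 ≠ 0 := by positivity
    rw [← h1] at hb
    rw [inv_pow]
    rw [div_eq_iff (by positivity)]
    field_simp
    linear_combination hb
  rw [e, ww]
  apply RR_mul (RR_mul (RR_nat _) (RR_nat _))
  apply RR_pow
  apply RR_inv _ (p64 hp5)
  exact_mod_cast RR_nat (p := p) 64

lemma RR_Ndiv (s d : ℕ) (hd : 0 < d) (h : ¬ p^s ∣ d) : RR p ((p:ℚ)^s/d) 0 := by
  have hp := (Fact.out : p.Prime)
  obtain ⟨v, t, ht, rfl⟩ := Nat.exists_eq_pow_mul_and_not_dvd hd.ne' p hp.ne_one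
  have hv : v < s := by
    by_contra hv
    push Not at hv
    exact h (Dvd.dvd.mul_right (pow_dvd_pow p hv) t)
  obtain ⟨w, rfl⟩ := Nat.exists_eq_add_of_lt hv
  have ht0 : (t:ℚ) ≠ 0 := by
    rintro h0
    have : t = 0 := by exact_mod_cast h0
    subst this; simp at ht
  have hp0 : (p:ℚ) ≠ 0 := by exact_mod_cast hp.ne_zero
  have e : (p:ℚ)^(v+w+1)/((p^v*t : ℕ):ℚ) = p * ((p:ℚ)^w/t) := by
    push_cast
    field_simp
    ring
  have ht1 : (t:ZMod p) ≠ 0 := by rwa [Ne, ZMod.natCast_eq_zero_iff]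
  rw [e]
  have := RR_mul (RR_nat (p := p) p) (RR_div (RR_pow (RR_nat (p := p) p) w) (RR_nat t) ht1)
  simpa using this

lemma RR_h (s i : ℕ) (h0 : 0 < i) (hi : i < p^(s+1)) :
    RR p ((p:ℚ)^s/i) (if p^s ∣ i then ((i/p^s : ℕ) : ZMod p)⁻¹ else 0) := by
  have hp := (Fact.out : p.Prime)
  split_ifs with h
  · obtain ⟨t, rfl⟩ := h
    have hp0 : (p:ℚ) ≠ 0 := by exact_mod_cast hp.ne_zero
    have hps : 0 < p^s := pow_pos hp.pos s
    have ht : 0 < t := Nat.pos_of_mul_pos_left h0 |> fun _ => by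
      rcases Nat.eq_zero_or_pos t with rfl | h
      · simp at h0
      · exact h
    have ht2 : t < p := by
      rw [pow_succ] at hi
      exact lt_of_mul_lt_mul_left hi hps.le
    rw [Nat.mul_div_cancel_left _ hps]
    have ht0 : (t:ℚ) ≠ 0 := by positivity
    rw [show (p:ℚ)^s/((p^s*t:ℕ):ℚ) = (t:ℚ)⁻¹ by push_cast; field_simp]
    exact RR_inv (RR_nat t) (natne ht ht2)
  · exact RR_Ndiv s i h0 h

/-- products -/
def ffp (N k : ℕ) : ℚ := ∏ i ∈ Finset.range k, (1 - (N:ℚ)/((i+1:ℕ):ℚ))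
def ggp (N k : ℕ) : ℚ := ∏ i ∈ Finset.range k, (1 + 4 * ((N:ℚ)/((4*i+1:ℕ):ℚ)))
def ddp (x : ℚ) (k : ℕ) : ℚ := ∏ i ∈ Finset.range k, (1 - x^2/((i+1:ℕ):ℚ)^2)

lemma ffp_eq (N k : ℕ) : poch (1-N) k = poch 1 k * ffp N k := by
  unfold poch ffp
  rw [← Finset.prod_mul_distrib]
  apply Finset.prod_congr rfl
  intro i _
  have : (i:ℚ)+1 ≠ 0 := by positivity
  push_cast
  field_simp
  ring

lemma ggp_eq (N k : ℕ) : poch (1/4+N) k = poch (1/4) k * ggp N k := by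
  unfold poch ggp
  rw [← Finset.prod_mul_distrib]
  apply Finset.prod_congr rfl
  intro i _
  have : 4*(i:ℚ)+1 ≠ 0 := by positivity
  push_cast
  field_simp
  ring

lemma ddp_eq (x : ℚ) (k : ℕ) : poch (1+x) k * poch (1-x) k = poch 1 k ^ 2 * ddp x k := by
  unfold poch ddp
  rw [← Finset.prod_mul_distrib, ← Finset.prod_pow, ← Finset.prod_mul_distrib]
  apply Finset.prod_congr rfl
  intro i _
  have : (i:ℚ)+1 ≠ 0 := by positivity
  push_cast
  field_simp
  ring

lemma RR_ffp (s k : ℕ) (hk : k < p^(s+1)) : RR p (ffp (p^(s+1)) k) 1 := by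
  induction k with
  | zero => simpa [ffp] using RR_one
  | succ k ih =>
    have h1 := RR_Ndiv (p := p) (s+1) (k+1) (by omega) (fun h => by
      have := Nat.le_of_dvd (by omega) h
      omega)
    have := RR_mul (ih (by omega)) (RR_sub RR_one h1)
    rw [sub_zero, mul_one] at this
    unfold ffp at this ⊢
    rw [Finset.prod_range_succ]
    push_cast at this ⊢
    exact this

lemma RR_ggp (hp5 : 5 ≤ p) (s n k : ℕ) (hn : 4*n+1 = 3*p^(s+1)) (hk : k ≤ p^(s+1)) :
    ∃ z, RR p (ggp (p^(s+1)) k) z ∧ (k ≤ n → z = 1) := by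
  have hp := (Fact.out : p.Prime)
  induction k with
  | zero => exact ⟨1, by simpa [ggp] using RR_one, fun _ => rfl⟩
  | succ k ih =>
    obtain ⟨z, hz, hz1⟩ := ih (by omega)
    have e : ggp (p^(s+1)) (k+1) = ggp (p^(s+1)) k * (1 + 4 * ((p:ℚ)^(s+1)/((4*k+1:ℕ):ℚ))) := by
      unfold ggp
      rw [Finset.prod_range_succ]; push_cast; rfl
    rw [e]
    have h4 : RR p 4 4 := by exact_mod_cast RR_nat (p := p) 4
    by_cases hkn : k = n
    · subst hkn
      have e2 : (1 + 4 * ((p:ℚ)^(s+1)/((4*k+1:ℕ):ℚ))) = 1 + 4 * (3:ℚ)⁻¹ := by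
        have hp0 : (p:ℚ) ≠ 0 := by exact_mod_cast hp.ne_zero
        rw [hn]; push_cast; field_simp
      have h3 : RR p 3 3 := by exact_mod_cast RR_nat (p := p) 3
      have h3' : (3:ZMod p) ≠ 0 := by exact_mod_cast natne (p := p) (k := 3) (by omega) (by omega)
      rw [e2]
      exact ⟨_, RR_mul hz (RR_add RR_one (RR_mul h4 (RR_inv h3 h3'))), fun h => by omega⟩
    · have h1 := RR_Ndiv (p := p) (s+1) (4*k+1) (by omega) (fun ⟨c, hc⟩ => by
        have hc4 : c < 4 := by
          by_contra h
          push Not at h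
          have := Nat.mul_le_mul_left (p^(s+1)) h
          omega
        interval_cases c <;> omega)
      have := RR_mul hz (RR_add RR_one (RR_mul h4 h1))
      rw [mul_zero, add_zero, mul_one] at this
      exact ⟨z, this, fun h => hz1 (by omega)⟩

def uu (N j : ℕ) : ℚ := poch (3/4) j * poch (1/4+N) j * poch (1-N) j / ((2*j+1) * poch 1 j ^ 3)

lemma RR_uu (hp5 : 5 ≤ p) (s n k : ℕ) (hn : 4*n+1 = 3*p^(s+1)) (hk : k < p^(s+1)) :
    RR p (uu (p^(s+1)) k) (ww p k) := by
  have e : uu (p^(s+1)) k = poch (3/4) k * poch (1/4) k / (poch 1 k ^ 2 * (2*k+1)) *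
      ggp (p^(s+1)) k * ffp (p^(s+1)) k := by
    unfold uu
    rw [ffp_eq, ggp_eq]
    have h0 := poch1_ne k
    have h2 : (2*k:ℚ)+1 ≠ 0 := by positivity
    field_simp
  obtain ⟨z, hz, hz1⟩ := RR_ggp hp5 s n k hn hk.le
  have := RR_mul (RR_mul (RR_base hp5 k) hz) (RR_ffp s k hk)
  rw [e]
  have e2 : ww p k * z * 1 = ww p k := by
    rcases le_or_gt k n with h | h
    · rw [hz1 h]; ring
    · have hodd : Odd p := (Fact.out : p.Prime).odd_of_ne_two (by omega)
      have : ww p k = 0 := by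
        rw [ww_eq, ww_top (s+1) k (by omega) hk hodd]; ring
      rw [this]; ring
  rwa [e2] at this

lemma p16 (hp5 : 5 ≤ p) : (16:ZMod p) ≠ 0 := by
  intro h
  apply p64 hp5
  rw [show (64:ZMod p) = 16*4 by norm_num, h, zero_mul]

lemma ddp_e (hp5 : 5 ≤ p) (s k : ℕ) (hk : k < p^(s+1)) :
    ∃ e, 1 / ddp (3*((p^(s+1):ℕ):ℚ)/4) k = 1 + (p:ℚ)^2 * e ∧ RR p e (9/16 * hz p (k/p^s)) := by
  induction k with
  | zero => exact ⟨0, by simp [ddp], by simpa [hz] using RR_zero⟩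
  | succ k ih =>
    obtain ⟨e, he, hR⟩ := ih (by omega)
    have hh := RR_h (p := p) s (k+1) (by omega) hk
    set h : ℚ := (p:ℚ)^s/((k+1:ℕ):ℚ) with hh0
    have h9 : RR p (9/16) (9/16) := RR_div (by exact_mod_cast RR_nat (p := p) 9)
      (by exact_mod_cast RR_nat (p := p) 16) (p16 hp5)
    have hc := RR_mul h9 (RR_pow hh 2)
    set c : ℚ := 9/16*h^2 with hc0
    have hd : RR p (1 - (p:ℚ)^2*c) 1 := by
      have := RR_sub RR_one (RR_mul (RR_pow (RR_nat (p := p) p) 2) hc)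
      simpa using this
    have hd0 := RR_ne hd one_ne_zero
    have hdd : ddp (3*((p^(s+1):ℕ):ℚ)/4) (k+1) = ddp (3*((p^(s+1):ℕ):ℚ)/4) k * (1 - (p:ℚ)^2*c) := by
      rw [ddp, Finset.prod_range_succ, ← ddp, hc0, hh0]
      push_cast
      congr 1
      have : (k:ℚ)+1 ≠ 0 := by positivity
      field_simp
      ring
    refine ⟨(e+c)/(1 - (p:ℚ)^2*c), ?_, ?_⟩
    · rw [hdd, ← div_div, he]
      field_simp
      ring
    · have := RR_div (RR_add hR hc) hd one_ne_zero
      convert this using 1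
      rw [div_one, Nat.succ_div]
      split_ifs with hdv
      · rw [hz_succ, inv_pow]
        push_cast
        ring
      · simp

lemma UU_eq (N : ℕ) (x : ℚ) : UU N x = ∑ k ∈ Finset.range N, uu N k * (1/ddp x k) := by
  unfold UU uu
  apply Finset.sum_congr rfl
  intro k _
  rw [mul_assoc ((2*k+1)*poch 1 k), ddp_eq, div_mul_div_comm, mul_one]
  congr 1; ring

lemma UU_zero (N : ℕ) : UU N 0 = ∑ k ∈ Finset.range N, uu N k := by
  rw [UU_eq]; simp [ddp]

lemma final_core (m : ℕ) (hm : p = 4*m+3) (hp5 : 5 ≤ p) (s : ℕ) (hs : Even s) :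
    ∃ y z, RR p y z ∧ (∑ k ∈ Finset.range (p^(s+1)), TT 0 k) -
      (3 * (p:ℚ)^(s+1) - 27/4 * (p:ℚ)^(s+3) * H2 (3*m+2)) = 3 * (p:ℚ)^(s+4) * y := by
  obtain ⟨n, hn⟩ : ∃ n, 4*n+1 = 3*p^(s+1) := by
    have h : p^(s+1) % 4 = 3 := by
      obtain ⟨t, rfl⟩ := hs
      rw [pow_succ, ← two_mul, pow_mul, Nat.mul_mod, Nat.pow_mod, Nat.pow_mod p 2]
      have : p % 4 = 3 := by omega
      rw [this]; norm_num
    exact ⟨(3*p^(s+1)-1)/4, by omega⟩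
  have hmain := main_ratio (p^(s+1)) n hn
  set x : ℚ := 3*((p^(s+1):ℕ):ℚ)/4 with hx
  have hE : ∀ k, ∃ e, k < p^(s+1) → 1 / ddp x k = 1 + (p:ℚ)^2 * e ∧ RR p e (9/16 * hz p (k/p^s)) := by
    intro k
    by_cases hk : k < p^(s+1)
    · obtain ⟨e, he⟩ := ddp_e hp5 s k hk
      exact ⟨e, fun _ => he⟩
    · exact ⟨0, fun h => absurd h hk⟩
  choose e he using hE
  set Q : ℚ := ∑ k ∈ Finset.range (p^(s+1)), uu (p^(s+1)) k * e k with hQ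
  have hU : UU (p^(s+1)) x = UU (p^(s+1)) 0 + (p:ℚ)^2 * Q := by
    rw [UU_eq, UU_zero, hQ, Finset.mul_sum, ← Finset.sum_add_distrib]
    apply Finset.sum_congr rfl
    intro k hk
    rw [(he k (by simpa using hk)).1]; ring
  have hRQ : RR p Q (9/16 * (-4 * hz p (3*m+2))) := by
    rw [← ww_weighted m hm hp5 s hs, Finset.mul_sum]
    apply RR_sum
    intro k hk
    have hk' : k < p^(s+1) := by simpa using hk
    have := RR_mul (RR_uu hp5 s n k hn hk') (he k hk').2
    convert this using 1
    ring
  have hR0 : RR p (UU (p^(s+1)) 0) (-1) := by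
    rw [← ww_total m hm hp5 (s+1) hs.add_one, UU_zero]
    apply RR_sum
    intro k hk
    exact RR_uu hp5 s n k hn (by simpa using hk)
  have hRx : RR p (UU (p^(s+1)) x) (-1) := by
    rw [hU]
    have := RR_add hR0 (RR_mul (RR_pow (RR_nat (p := p) p) 2) hRQ)
    simpa using this
  have hm1 : (-1 : ZMod p) ≠ 0 := neg_ne_zero.mpr one_ne_zero
  have hx0 := RR_ne hRx hm1
  have h16 := p16 (p := p) hp5
  have h4 : (4:ZMod p) ≠ 0 := by exact_mod_cast natne (p := p) (k := 4) (by omega) (by omega)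
  have h94 : RR p (9/4) (9/4) := RR_div (by exact_mod_cast RR_nat (p := p) 9)
      (by exact_mod_cast RR_nat (p := p) 4) h4
  have hB := RR_add (RR_neg (RR_div hRQ hRx hm1)) (RR_mul h94 (RR_H2 (p := p) (3*m+2) (by omega)))
  have hB0 : -(9/16 * (-4 * hz p (3*m+2)) / -1) + 9/4 * hz p (3*m+2) = 0 := by
    have : (16:ZMod p) = 4*4 := by norm_num
    rw [this]
    field_simp
    ring
  rw [hB0] at hB
  obtain ⟨y, z, hy, hz⟩ := RR_dvd hB
  refine ⟨y, z, hz, ?_⟩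
  have hS : (∑ k ∈ Finset.range (p^(s+1)), TT 0 k) = 3 * (p:ℚ)^(s+1) * (1 - (p:ℚ)^2 * (Q / UU (p^(s+1)) x)) := by
    rw [eq_div_of_mul_eq hx0 hmain]
    have : UU (p^(s+1)) 0 = UU (p^(s+1)) x - (p:ℚ)^2 * Q := by rw [hU]; ring
    rw [this]
    push_cast
    field_simp
  rw [hS]
  linear_combination 3 * (p:ℚ)^(s+3) * hy

end

theorem stmt16 (p : ℕ) (hp : p.Prime) (hp5 : 5 ≤ p) (hp4 : p % 4 = 3)
    (r : ℕ) (hr : 1 ≤ r) (hrodd : Odd r) :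
    ratCongr p ((r : ℤ) + 3)
      (∑ k ∈ Finset.range (p ^ r),
        (8 * (k : ℚ) + 1) * poch (1/4) k ^ 3 * poch (1/2) k /
          (poch 1 k ^ 3 * poch (3/4) k))
      (3 * (p : ℚ) ^ r - 27 / 4 * (p : ℚ) ^ (r + 2) * H2 ((3 * p - 1) / 4)) := by
  have := Fact.mk hp
  obtain ⟨s, rfl⟩ : ∃ s, r = s + 1 := ⟨r - 1, by omega⟩
  have hs : Even s := by
    rcases Nat.even_or_odd s with h | h
    · exact h
    · exact absurd hrodd (by simpa using h.add_one)
  obtain ⟨y, z, hz, h⟩ := final_core (p/4) (by omega : p = 4*(p/4)+3) hp5 s hs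
  have e1 : ∑ k ∈ Finset.range (p ^ (s+1)),
        (8 * (k : ℚ) + 1) * poch (1/4) k ^ 3 * poch (1/2) k /
          (poch 1 k ^ 3 * poch (3/4) k) = ∑ k ∈ Finset.range (p^(s+1)), TT 0 k := by
    apply Finset.sum_congr rfl
    intro k _
    rw [TT, sub_zero, add_zero, add_zero, sub_zero]
    congr 1 <;> ring
  rw [e1, show (3*p-1)/4 = 3*(p/4)+2 by omega]
  unfold ratCongr
  rw [show s + 1 + 2 = s + 3 by ring, h]
  by_cases hy : y = 0
  · left
    rw [hy, mul_zero, sub_eq_zero] at h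
    exact h
  · right
    have hp0 : (p:ℚ) ≠ 0 := by exact_mod_cast hp.ne_zero
    rw [padicValRat.mul (by positivity) hy, padicValRat.mul (by norm_num) (by positivity),
      padicValRat.pow, padicValRat.self hp.one_lt]
    have h3 : 0 ≤ padicValRat p (3:ℚ) := by
      have := RR_val (p := p) (y := 3) (z := 3) (by exact_mod_cast RR_nat (p := p) 3) (by norm_num)
      exact this
    have := RR_val hz hy
    push_cast
    linarith
end
end

section
/- For any prime p ≥ 5 with p ≡ 3 (mod 4) and any odd positive integer r, p^{2r} ∑_{j=1}^{(p^r−3)/4} 1/j^2 ≡ p^2 ∑_{j=1}^{(p−3)/4} 1/j^2 (mod p^3). -/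
noncomputable section

theorem stmt17 (p : ℕ) (hp : p.Prime) (hp5 : 5 ≤ p) (hp4 : p % 4 = 3)
    (r : ℕ) (hr : 1 ≤ r) (hrodd : Odd r) :
    ratCongr p 3
      ((p : ℚ) ^ (2 * r) * ∑ j ∈ Finset.Icc 1 ((p ^ r - 3) / 4), 1 / (j : ℚ) ^ 2)
      ((p : ℚ) ^ 2 * ∑ j ∈ Finset.Icc 1 ((p - 3) / 4), 1 / (j : ℚ) ^ 2) := by
  have : Fact p.Prime := ⟨hp⟩
  obtain ⟨s, rfl⟩ : ∃ s, r = s + 1 := ⟨r - 1, by omega⟩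
  obtain ⟨q, rfl⟩ : ∃ q, p = 4 * q + 3 := ⟨p / 4, by omega⟩
  have hq : (4 * q + 3 - 3) / 4 = q := by omega
  rw [hq]
  generalize hpp : 4 * q + 3 = p at *
  have hp0 : (p : ℚ) ≠ 0 := by exact_mod_cast hp.ne_zero
  have hP : 1 ≤ p ^ s := Nat.one_le_pow _ _ hp.pos
  have himg : (Finset.Icc 1 ((p ^ (s + 1) - 3) / 4)).filter (fun j => p ^ s ∣ j)
      = (Finset.Icc 1 q).image (fun k => p ^ s * k) := by
    have hexp : p ^ (s + 1) = 4 * (p ^ s * q) + 3 * p ^ s := by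
      rw [pow_succ, ← hpp]; ring
    ext j
    simp only [Finset.mem_filter, Finset.mem_Icc, Finset.mem_image]
    constructor
    · rintro ⟨⟨h1, h2⟩, k, rfl⟩
      refine ⟨k, ⟨?_, ?_⟩, rfl⟩
      · rcases Nat.eq_zero_or_pos k with h | h
        · subst h; simp at h1
        · exact h
      · by_contra hk
        have h3 : p ^ s * (q + 1) ≤ p ^ s * k := Nat.mul_le_mul_left _ (by omega)
        rw [Nat.mul_add] at h3
        omega
    · rintro ⟨k, ⟨h1, h2⟩, rfl⟩
      have h3 : p ^ s * k ≤ p ^ s * q := Nat.mul_le_mul_left _ h2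
      have h4 : p ^ s * 1 ≤ p ^ s * k := Nat.mul_le_mul_left _ h1
      exact ⟨⟨by omega, by omega⟩, dvd_mul_right _ _⟩
  have hmain : (p : ℚ) ^ (2 * (s + 1)) *
        ∑ j ∈ (Finset.Icc 1 ((p ^ (s + 1) - 3) / 4)).filter (fun j => p ^ s ∣ j), 1 / (j : ℚ) ^ 2
      = (p : ℚ) ^ 2 * ∑ j ∈ Finset.Icc 1 q, 1 / (j : ℚ) ^ 2 := by
    rw [himg, Finset.sum_image, Finset.mul_sum, Finset.mul_sum]
    · refine Finset.sum_congr rfl fun k hk => ?_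
      have hk0 : (k : ℚ) ≠ 0 := by
        have := (Finset.mem_Icc.1 hk).1
        exact_mod_cast (by omega : k ≠ 0)
      push_cast
      field_simp
      ring
    · intro a _ b _ h
      exact Nat.eq_of_mul_eq_mul_left hP h
  have hdiff := Finset.sum_filter_add_sum_filter_not (Finset.Icc 1 ((p ^ (s + 1) - 3) / 4))
    (fun j => p ^ s ∣ j) (fun j => 1 / (j : ℚ) ^ 2)
  rw [← hdiff, mul_add, hmain]
  unfold ratCongr
  rw [add_sub_cancel_left, or_iff_not_imp_left]
  intro hne
  have hne' := fun h => hne (add_eq_left.2 h)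
  rw [Finset.mul_sum] at hne' ⊢
  have hb : padicNorm p (∑ j ∈ (Finset.Icc 1 ((p ^ (s + 1) - 3) / 4)).filter
      (fun j => ¬ p ^ s ∣ j), (p : ℚ) ^ (2 * (s + 1)) * (1 / (j : ℚ) ^ 2)) ≤ (p : ℚ) ^ (-3 : ℤ) := by
    refine padicNorm.sum_le' (fun j hj => ?_) (by positivity)
    simp only [Finset.mem_filter, Finset.mem_Icc] at hj
    obtain ⟨⟨h1, -⟩, h2⟩ := hj
    have hj0 : (j : ℚ) ≠ 0 := by exact_mod_cast (by omega : j ≠ 0)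
    have hv : padicValNat p j < s := by
      by_contra h
      exact h2 ((padicValNat_dvd_iff_le (by omega)).2 (by omega))
    rw [padicNorm.eq_zpow_of_nonzero (by positivity)]
    refine zpow_le_zpow_right₀ (by exact_mod_cast hp.one_le) ?_
    rw [padicValRat.mul (by positivity) (by positivity), padicValRat.div one_ne_zero (by positivity),
      padicValRat.pow, padicValRat.pow, padicValRat.one, padicValRat.self hp.one_lt]
    have hvr : padicValRat p (j : ℚ) = (padicValNat p j : ℤ) := padicValRat.of_nat
    push_cast
    omega
  rw [padicNorm.eq_zpow_of_nonzero hne'] at hb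
  have := (zpow_le_zpow_iff_right₀ (by exact_mod_cast hp.one_lt : (1 : ℚ) < p)).1 hb
  omega
end
end

section
/- For any odd positive integer r, ∑_{k=0}^{3^r−1} (8k+1) · (1/4)_k^3 (1/2)_k / ((1)_k^3 (3/4)_k) ≡ 3^{r+1} (mod 3^{r+3}). -/
noncomputable section

open Finset

def O3 : Subring ℚ where
  carrier := {x | 0 ≤ padicValRat 3 x}
  mul_mem' := by
    intro a b ha hb
    simp only [Set.mem_ofPred_eq] at *
    by_cases h1 : a = 0
    · simp [h1]
    by_cases h2 : b = 0
    · simp [h2]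
    rw [padicValRat.mul h1 h2]; omega
  one_mem' := by simp
  add_mem' := by
    intro a b ha hb
    simp only [Set.mem_ofPred_eq] at *
    by_cases h : a + b = 0
    · simp [h]
    exact le_trans (le_min ha hb) (padicValRat.min_le_padicValRat_add h)
  zero_mem' := by simp
  neg_mem' := by
    intro a ha
    simpa using ha

lemma O3_int (z : ℤ) : (z : ℚ) ∈ O3 := intCast_mem O3 z

lemma O3_inv (z : ℤ) (h : ¬ (3 : ℤ) ∣ z) : ((z : ℚ))⁻¹ ∈ O3 := by
  change 0 ≤ padicValRat 3 _
  rw [padicValRat.inv, padicValRat.of_int, padicValInt.eq_zero_of_not_dvd (by exact_mod_cast h)]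
  simp

lemma O3_div (a b : ℤ) (h : ¬ (3 : ℤ) ∣ b) : (a : ℚ) / b ∈ O3 := by
  rw [div_eq_mul_inv]; exact O3.mul_mem (O3_int a) (O3_inv b h)

lemma nd_mul {a b : ℤ} (ha : ¬ (3 : ℤ) ∣ a) (hb : ¬ (3 : ℤ) ∣ b) : ¬ (3 : ℤ) ∣ a * b := by
  intro h
  rcases (Int.prime_three).dvd_or_dvd h with h | h
  · exact ha h
  · exact hb h

/-- congruence mod 9 -/
def C9 (x y : ℚ) : Prop := (x - y) / 9 ∈ O3

lemma C9.refl (x : ℚ) : C9 x x := by simp [C9, O3.zero_mem]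

lemma C9.add {a b c d : ℚ} (h : C9 a b) (h' : C9 c d) : C9 (a + c) (b + d) := by
  have := O3.add_mem h h'
  unfold C9; convert this using 1; ring

lemma C9.trans {a b c : ℚ} (h : C9 a b) (h' : C9 b c) : C9 a c := by
  have := O3.add_mem h h'
  unfold C9; convert this using 1; ring

lemma C9.mul {a b c d : ℚ} (h : C9 a b) (h' : C9 c d) (hc : c ∈ O3) (hb : b ∈ O3) :
    C9 (a * c) (b * d) := by
  have := O3.add_mem (O3.mul_mem h hc) (O3.mul_mem hb h')
  unfold C9; convert this using 1; ring

lemma C9_div (a b c : ℤ) (hb : ¬ (3 : ℤ) ∣ b) (h : (9 : ℤ) ∣ a - c * b) :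
    C9 ((a : ℚ) / b) c := by
  obtain ⟨k, hk⟩ := h
  have hb0 : (b : ℚ) ≠ 0 := by
    intro h0
    have : b = 0 := by exact_mod_cast h0
    exact hb (by simp [this])
  have := O3_div k b hb
  unfold C9
  convert this using 1
  have hk' : (a : ℚ) - c * b = 9 * k := by exact_mod_cast hk
  field_simp
  linarith

lemma C9.mem {a b : ℚ} (h : C9 a b) (hb : b ∈ O3) : a ∈ O3 := by
  have := O3.add_mem (O3.mul_mem (O3_int 9) h) hb
  convert this using 1; push_cast; ring

lemma O3_num (n : ℕ) : (n : ℚ) ∈ O3 := natCast_mem O3 n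

/-! the hypergeometric identity -/

def rho (a b : ℚ) (i : ℚ) : ℚ :=
  (2 * i + 1) * (4 * i + 1 + 4 * a) * (i - b) / ((4 * i + 3) * (2 * i + 2) * (i + 1))

def U (a b : ℚ) (k : ℕ) : ℚ := ∏ i ∈ range k, rho a b i

lemma U_zero (a b : ℚ) : U a b 0 = 1 := by simp [U]

lemma U_succ (a b : ℚ) (k : ℕ) : U a b (k + 1) = U a b k * rho a b k := by
  simp [U, prod_range_succ]

lemma U1 (N : ℚ) (j : ℕ) : U (N + 1) N j * (4 * N + 1) = U N N j * (4 * N + 4 * j + 1) := by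
  induction j with
  | zero => simp [U_zero]
  | succ j ih =>
    rw [U_succ, U_succ]
    unfold rho
    push_cast
    linear_combination ((2 * (j : ℚ) + 1) * (4 * j + 1 + 4 * (N + 1)) * (j - N) / ((4 * j + 3) * (2 * j + 2) * (j + 1))) * ih

lemma U2 (N : ℚ) (j : ℕ) : U N (N - 1) j * N = U N N j * (N - j) := by
  induction j with
  | zero => simp [U_zero]
  | succ j ih =>
    rw [U_succ, U_succ]
    unfold rho
    push_cast
    linear_combination ((2 * (j : ℚ) + 1) * (4 * j + 1 + 4 * N) * (j - (N - 1)) / ((4 * j + 3) * (2 * j + 2) * (j + 1))) * ih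

lemma U_vanish (a : ℚ) (N j : ℕ) (h : N < j) : U a N j = 0 := by
  unfold U
  apply prod_eq_zero (mem_range.2 h)
  simp [rho]

lemma U3 (N : ℚ) (j : ℕ) : U (N + 1) (N + 1) (j + 1) * (4 * N + 1) =
    U N N j * (-(N + 1)) * (4 * N + 4 * j + 1) * (4 * N + 4 * j + 5) * (2 * j + 1) /
      (2 * (j + 1) ^ 2 * (4 * j + 3)) := by
  induction j with
  | zero => rw [U_succ]; simp [U_zero, rho]; ring
  | succ j ih =>
    rw [U_succ _ _ (j + 1), U_succ N N j]
    have h : U (N + 1) (N + 1) (j + 1) * rho (N + 1) (N + 1) ↑(j + 1) * (4 * N + 1) =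
      U (N + 1) (N + 1) (j + 1)  * (4 * N + 1) * rho (N + 1) (N + 1) ↑(j + 1) := by ring
    rw [h, ih]
    unfold rho
    push_cast
    have h1 : (j : ℚ) + 1 ≠ 0 := by positivity
    have h2 : 4 * (j : ℚ) + 3 ≠ 0 := by positivity
    have h3 : (j : ℚ) + 1 + 1 ≠ 0 := by positivity
    have h4 : 4 * ((j : ℚ) + 1) + 3 ≠ 0 := by positivity
    field_simp
    ring

lemma saal_step (N : ℕ) (J : ℕ) :
    (4 * (N : ℚ) + 1) * ∑ j ∈ range (J + 1), ((4 * (N : ℚ) + 3) * (2 * N + 2) * U (N + 1) (N + 1) j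
      - (2 * N + 1) * (4 * N + 1) * U N N j) =
    (8 * N + 5) * U N N J * (4 * N + 4 * J + 1) * (2 * J + 1) := by
  induction J with
  | zero => simp [U_zero]; ring
  | succ J ih =>
    rw [sum_range_succ, mul_add, ih]
    have h3 := U3 N J
    have h : (4 * (N : ℚ) + 1) * ((4 * (N : ℚ) + 3) * (2 * N + 2) * U (N + 1) (N + 1) (J + 1)
      - (2 * N + 1) * (4 * N + 1) * U N N (J + 1)) =
      (4 * (N : ℚ) + 3) * (2 * N + 2) * (U (N + 1) (N + 1) (J + 1) * (4 * (N : ℚ) + 1))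
      - (2 * N + 1) * (4 * N + 1) ^ 2 * U N N (J + 1) := by ring
    rw [h, h3, U_succ]
    unfold rho
    push_cast
    have h1 : (J : ℚ) + 1 ≠ 0 := by positivity
    have h2 : 4 * (J : ℚ) + 3 ≠ 0 := by positivity
    field_simp
    ring

def W (k : ℕ) : ℚ := ∏ j ∈ range k, ((2 * (j : ℚ) + 1) * (4 * j + 1) / ((4 * j + 3) * (2 * j + 2)))

lemma saal_s19 (N : ℕ) : ∑ j ∈ range (N + 1), U N N j = W N := by
  induction N with
  | zero => simp [U_zero, W]
  | succ N ih =>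
    have h := saal_step N (N + 1)
    rw [U_vanish _ N (N + 1) (by omega)] at h
    have h1 : 4 * (N : ℚ) + 1 ≠ 0 := by positivity
    have h2 : ∑ j ∈ range (N + 1 + 1), ((4 * (N : ℚ) + 3) * (2 * N + 2) * U (N + 1) (N + 1) j
      - (2 * N + 1) * (4 * N + 1) * U N N j) = 0 := by
      have : (4 * (N : ℚ) + 1) * ∑ j ∈ range (N + 1 + 1), ((4 * (N : ℚ) + 3) * (2 * N + 2) * U (N + 1) (N + 1) j
      - (2 * N + 1) * (4 * N + 1) * U N N j) = 0 := by rw [h]; ring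
      exact (mul_eq_zero.1 this).resolve_left h1
    rw [sum_sub_distrib, ← mul_sum, ← mul_sum, sum_range_succ (fun j => U (N : ℚ) N j) (N + 1),
      U_vanish _ N (N + 1) (by omega), add_zero, ih] at h2
    unfold W at *
    rw [prod_range_succ]
    push_cast
    have h3 : 4 * (N : ℚ) + 3 ≠ 0 := by positivity
    have h4 : 2 * (N : ℚ) + 2 ≠ 0 := by positivity
    rw [mul_div_assoc', eq_div_iff (by positivity)]
    linarith

def A (k : ℕ) : ℚ := ∏ j ∈ range k, ((4 * (j : ℚ) + 1) / (4 * (j + 1)))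

lemma whipple_s19 (N : ℕ) : ∑ k ∈ range N, (8 * (k : ℚ) + 1) * A k ^ 2 * W k =
    16 * N ^ 2 * A N ^ 2 * ∑ j ∈ range N, U N (N - 1) j / (4 * j + 1) := by
  induction N with
  | zero => simp
  | succ N ih =>
    have e : (N : ℚ) * ∑ j ∈ range N, U N (N - 1) j / (4 * j + 1) =
        ∑ j ∈ range (N + 1), U N N j * (N - j) / (4 * j + 1) := by
      rw [sum_range_succ, mul_sum]
      simp only [sub_self, mul_zero, zero_div, add_zero]
      refine sum_congr rfl fun j _ => ?_
      rw [← U2]; ring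
    have hA : A (N + 1) = A N * ((4 * (N : ℚ) + 1) / (4 * (N + 1))) := by
      unfold A; rw [prod_range_succ]
    rw [sum_range_succ, ih, ← saal_s19, hA]
    push_cast
    have h1 : (N : ℚ) + 1 ≠ 0 := by positivity
    have e2 : (4 * (N : ℚ) + 1) * ∑ j ∈ range (N + 1), U (N + 1) (N + 1 - 1) j / (4 * j + 1) =
        ∑ j ∈ range (N + 1), U N N j * (4 * N + 4 * j + 1) / (4 * j + 1) := by
      rw [mul_sum]
      refine sum_congr rfl fun j _ => ?_
      rw [← U1, add_sub_cancel_right]; ring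
    have e3 : 16 * ((N : ℚ) + 1) ^ 2 * (A N * ((4 * (N : ℚ) + 1) / (4 * (N + 1)))) ^ 2 *
        ∑ j ∈ range (N + 1), U (N + 1) (N + 1 - 1) j / (4 * j + 1) =
        A N ^ 2 * (4 * N + 1) * ((4 * (N : ℚ) + 1) * ∑ j ∈ range (N + 1), U (N + 1) (N + 1 - 1) j / (4 * j + 1)) := by
      field_simp
      ring
    have e4 : 16 * (N : ℚ) ^ 2 * A N ^ 2 * ∑ j ∈ range N, U N (N - 1) j / (4 * j + 1) =
       16 * N * A N ^ 2 * (N * ∑ j ∈ range N, U N (N - 1) j / (4 * j + 1)) := by ring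
    rw [e3, e4, e, e2, mul_sum, mul_sum, mul_sum, ← sum_add_distrib]
    refine sum_congr rfl fun j _ => ?_
    have h5 : 4 * (j : ℚ) + 1 ≠ 0 := by positivity
    field_simp
    ring

lemma term_eq (k : ℕ) : (8 * (k : ℚ) + 1) * poch (1/4) k ^ 3 * poch (1/2) k /
          (poch 1 k ^ 3 * poch (3/4) k) = (8 * (k : ℚ) + 1) * A k ^ 2 * W k := by
  have hA : A k = poch (1/4) k / poch 1 k := by
    unfold A poch
    rw [← prod_div_distrib]
    refine prod_congr rfl fun j _ => ?_
    have h1 : (j : ℚ) + 1 ≠ 0 := by positivity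
    have h2 : 1 + (j : ℚ) ≠ 0 := by positivity
    field_simp
    ring
  have hW : W k = poch (1/2) k * poch (1/4) k / (poch (3/4) k * poch 1 k) := by
    unfold W poch
    rw [← prod_mul_distrib, ← prod_mul_distrib, ← prod_div_distrib]
    refine prod_congr rfl fun j _ => ?_
    have h1 : (j : ℚ) + 1 ≠ 0 := by positivity
    have h2 : 1 + (j : ℚ) ≠ 0 := by positivity
    have h3 : 3 / 4 + (j : ℚ) ≠ 0 := by positivity
    have h4 : 4 * (j : ℚ) + 3 ≠ 0 := by positivity
    field_simp
    ring
  rw [hA, hW]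
  ring

/-! 3-adic analysis -/

lemma nine_dvd (x : ℤ) (h : (x : ZMod 9) = 0) : (9 : ℤ) ∣ x :=
  (ZMod.intCast_zmod_eq_zero_iff_dvd x 9).1 h

def r1 (x : ℚ) : ℚ := (2 * x + 1) / (2 * x + 2)
def r2 (a x : ℚ) : ℚ := (4 * x + 1 + 4 * a) / (4 * x + 3)
def r3 (a x : ℚ) : ℚ := (x + 1 - a) / (x + 1)

lemma rho_eq (a x : ℚ) : rho a (a - 1) x = r1 x * r2 a x * r3 a x := by
  unfold rho r1 r2 r3
  rw [div_mul_div_comm, div_mul_div_comm]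
  congr 1 <;> ring

lemma blk1 (i : ℕ) : ∃ z, C9 z 1 ∧ r1 (9 * i + 2) * r1 (9 * i + 3) * r1 (9 * i + 4) * r1 (9 * i + 5) *
    r1 (9 * i + 6) * r1 (9 * i + 7) * r1 (9 * i + 8) * r1 (9 * i + 9) * r1 (9 * i + 10) =
    r1 i * z := by
  have h := C9_div ((18*(i:ℤ)+5)*(18*i+7)*(18*i+11)*(18*i+13)*(6*i+5)*(18*i+17)*(18*i+19)*(6*i+7))
    ((6*i+2)*(18*i+8)*(18*i+10)*(6*i+4)*(18*i+14)*(18*i+16)*(18*i+20)*(18*i+22)) 1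
    (by repeat' apply nd_mul
        all_goals omega)
    (by
      apply nine_dvd 
      push_cast
      generalize (i : ZMod 9) = x
      revert x
      decide)
  refine ⟨_, by simpa only [Int.cast_one, Int.cast_ofNat] using h, ?_⟩
  unfold r1
  push_cast
  have : (2 * (i:ℚ) + 2) ≠ 0 := by positivity
  field_simp
  ring

lemma blk2 (L i : ℕ) : ∃ z, C9 z 7 ∧ r2 (27*L) (9 * i + 2) * r2 (27*L) (9 * i + 3) * r2 (27*L) (9 * i + 4) * r2 (27*L) (9 * i + 5) *
    r2 (27*L) (9 * i + 6) * r2 (27*L) (9 * i + 7) * r2 (27*L) (9 * i + 8) * r2 (27*L) (9 * i + 9) * r2 (27*L) (9 * i + 10) =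
    r2 (3*L) i * z := by
  have h := C9_div ((36*(i:ℤ)+108*L+13)*(36*i+108*L+17)*(12*i+36*L+7)*(36*i+108*L+25)*(36*i+108*L+29)*(12*i+36*L+11)*(36*i+108*L+37)*(36*i+108*L+41))
    ((36*i+11)*(12*i+5)*(36*i+19)*(36*i+23)*(36*i+31)*(36*i+35)*(12*i+13)*(36*i+43)) 7
    (by repeat' apply nd_mul
        all_goals omega)
    (by
      apply nine_dvd
      push_cast
      have h1 : (36 : ZMod 9) = 0 := rfl
      have h2 : (108 : ZMod 9) = 0 := rfl
      rw [h1, h2]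
      simp only [zero_mul, zero_add, add_zero]
      generalize (i : ZMod 9) = x
      revert x
      decide)
  refine ⟨_, by simpa only [Int.cast_one, Int.cast_ofNat] using h, ?_⟩
  unfold r2
  push_cast
  have : (4 * (i:ℚ) + 3) ≠ 0 := by positivity
  field_simp
  ring

lemma blk3 (L i : ℕ) : ∃ z, C9 z 1 ∧ r3 (27*L) (9 * i + 2) * r3 (27*L) (9 * i + 3) * r3 (27*L) (9 * i + 4) * r3 (27*L) (9 * i + 5) *
    r3 (27*L) (9 * i + 6) * r3 (27*L) (9 * i + 7) * r3 (27*L) (9 * i + 8) * r3 (27*L) (9 * i + 9) * r3 (27*L) (9 * i + 10) =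
    r3 (3*L) i * z := by
  have h := C9_div ((3*(i:ℤ)+1-9*L)*(9*i+4-27*L)*(9*i+5-27*L)*(3*i+2-9*L)*(9*i+7-27*L)*(9*i+8-27*L)*(9*i+10-27*L)*(9*i+11-27*L))
    ((3*i+1)*(9*i+4)*(9*i+5)*(3*i+2)*(9*i+7)*(9*i+8)*(9*i+10)*(9*i+11)) 1
    (by repeat' apply nd_mul
        all_goals omega)
    (by
      apply nine_dvd
      push_cast
      have h1 : (9 : ZMod 9) = 0 := rfl
      have h2 : (27 : ZMod 9) = 0 := rfl
      rw [h1, h2]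
      ring)
  refine ⟨_, by simpa only [Int.cast_one, Int.cast_ofNat] using h, ?_⟩
  unfold r3
  push_cast
  have : ((i:ℚ) + 1) ≠ 0 := by positivity
  field_simp
  ring

def V (a : ℚ) (k : ℕ) : ℚ := U a (a - 1) k

lemma V_succ (a : ℚ) (k : ℕ) : V a (k + 1) = V a k * rho a (a - 1) k := U_succ _ _ _

lemma O3_ofNat (n : ℕ) [n.AtLeastTwo] : (OfNat.ofNat n : ℚ) ∈ O3 := ofNat_mem O3 n

lemma V9 (a : ℚ) (m : ℕ) : V a (9 * (m + 1) + 2) = V a (9 * m + 2) *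
    (rho a (a - 1) (9 * m + 2) * rho a (a - 1) (9 * m + 3) * rho a (a - 1) (9 * m + 4) *
    rho a (a - 1) (9 * m + 5) * rho a (a - 1) (9 * m + 6) * rho a (a - 1) (9 * m + 7) *
    rho a (a - 1) (9 * m + 8) * rho a (a - 1) (9 * m + 9) * rho a (a - 1) (9 * m + 10)) := by
  have e : 9 * (m + 1) + 2 = 9 * m + 2 + 1 + 1 + 1 + 1 + 1 + 1 + 1 + 1 + 1 := by ring
  rw [e]
  simp only [V_succ a]
  push_cast
  ring

lemma zlem (L m : ℕ) : ∃ z, C9 z (7 ^ (m + 1)) ∧ V (27 * L) (9 * m + 2) = z * V (3 * L) m := by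
  induction m with
  | zero =>
    have h := C9_div ((1+108*(L:ℤ))*(5+108*L)*(1-27*L)*(2-27*L)) (7*2*4*2) 7 (by norm_num) (by
      apply nine_dvd
      push_cast
      have h1 : (108 : ZMod 9) = 0 := rfl
      have h2 : (27 : ZMod 9) = 0 := rfl
      rw [h1, h2]
      ring_nf
      rfl)
    refine ⟨_, by simpa using h, ?_⟩
    simp only [V, U_succ, U_zero, mul_zero, zero_add, rho]
    push_cast
    ring
  | succ m ih =>
    obtain ⟨z, hz, hv⟩ := ih
    obtain ⟨z1, hz1, h1⟩ := blk1 m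
    obtain ⟨z2, hz2, h2⟩ := blk2 L m
    obtain ⟨z3, hz3, h3⟩ := blk3 L m
    refine ⟨z * (z2 * (z1 * z3)), ?_, ?_⟩
    · have m1 : z1 ∈ O3 := hz1.mem O3.one_mem
      have m2 : z2 ∈ O3 := hz2.mem (O3_ofNat 7)
      have m3 : z3 ∈ O3 := hz3.mem O3.one_mem
      have := hz.mul (hz2.mul (hz1.mul hz3 m3 O3.one_mem) (O3.mul_mem m1 m3) (O3_ofNat 7))
        (O3.mul_mem m2 (O3.mul_mem m1 m3)) (O3.pow_mem (O3_ofNat 7) (m + 1))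
      convert this using 1
      ring
    · rw [V9, hv, V_succ]
      simp only [rho_eq]
      linear_combination z * V (3 * L) m * (r2 (27*L) (9 * m + 2) * r2 (27*L) (9 * m + 3) * r2 (27*L) (9 * m + 4) * r2 (27*L) (9 * m + 5) *
    r2 (27*L) (9 * m + 6) * r2 (27*L) (9 * m + 7) * r2 (27*L) (9 * m + 8) * r2 (27*L) (9 * m + 9) * r2 (27*L) (9 * m + 10)) * (r3 (27*L) (9 * m + 2) * r3 (27*L) (9 * m + 3) * r3 (27*L) (9 * m + 4) * r3 (27*L) (9 * m + 5) *
    r3 (27*L) (9 * m + 6) * r3 (27*L) (9 * m + 7) * r3 (27*L) (9 * m + 8) * r3 (27*L) (9 * m + 9) * r3 (27*L) (9 * m + 10)) * h1 +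
       z * V (3 * L) m * (r1 m * z1) * (r3 (27*L) (9 * m + 2) * r3 (27*L) (9 * m + 3) * r3 (27*L) (9 * m + 4) * r3 (27*L) (9 * m + 5) *
    r3 (27*L) (9 * m + 6) * r3 (27*L) (9 * m + 7) * r3 (27*L) (9 * m + 8) * r3 (27*L) (9 * m + 9) * r3 (27*L) (9 * m + 10)) * h2 +
       z * V (3 * L) m * (r1 m * z1) * (r2 (3*L) m * z2) * h3

lemma Astep (i : ℕ) : ∃ z, C9 z 1 ∧ A (9 * i) = A i * z := by
  induction i with
  | zero => exact ⟨1, C9.refl 1, by simp⟩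
  | succ i ih =>
    obtain ⟨z, hz, hv⟩ := ih
    have h := C9_div ((36*(i:ℤ)+1)*(36*i+5)*(36*i+13)*(36*i+17)*(12*i+7)*(36*i+25)*(36*i+29)*(12*i+11))
      ((36*i+4)*(36*i+8)*(12*i+4)*(36*i+16)*(36*i+20)*(12*i+8)*(36*i+28)*(36*i+32)) 1
      (by repeat' apply nd_mul
          all_goals omega)
      (by
        apply nine_dvd
        push_cast
        have h1 : (36 : ZMod 9) = 0 := rfl
        rw [h1]
        simp only [zero_mul, zero_add]
        generalize (i : ZMod 9) = x
        revert x
        decide)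
    rw [Int.cast_one] at h
    refine ⟨_, by simpa using hz.mul h (h.mem O3.one_mem) O3.one_mem, ?_⟩
    have hA : ∀ N, A (N + 1) = A N * ((4 * (N : ℚ) + 1) / (4 * (N + 1))) := by
      intro N; unfold A; rw [prod_range_succ]
    have e : A (9 * (i + 1)) = A (9 * i) * (((4 * (9 * (i:ℚ)) + 1) / (4 * (9 * i + 1))) *
        ((4 * (9 * (i:ℚ) + 1) + 1) / (4 * (9 * i + 1 + 1))) *
        ((4 * (9 * (i:ℚ) + 2) + 1) / (4 * (9 * i + 2 + 1))) *
        ((4 * (9 * (i:ℚ) + 3) + 1) / (4 * (9 * i + 3 + 1))) *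
        ((4 * (9 * (i:ℚ) + 4) + 1) / (4 * (9 * i + 4 + 1))) *
        ((4 * (9 * (i:ℚ) + 5) + 1) / (4 * (9 * i + 5 + 1))) *
        ((4 * (9 * (i:ℚ) + 6) + 1) / (4 * (9 * i + 6 + 1))) *
        ((4 * (9 * (i:ℚ) + 7) + 1) / (4 * (9 * i + 7 + 1))) *
        ((4 * (9 * (i:ℚ) + 8) + 1) / (4 * (9 * i + 8 + 1)))) := by
      have e : 9 * (i + 1) = 9 * i + 1 + 1 + 1 + 1 + 1 + 1 + 1 + 1 + 1 := by ring
      rw [e]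
      simp only [hA _]
      push_cast
      simp only [add_assoc, mul_assoc]
    rw [e, hv, hA i]
    push_cast
    have : (i : ℚ) + 1 ≠ 0 := by positivity
    field_simp
    ring

lemma mulfrac {y w : ℚ} (hy : y ∈ O3) (a b : ℤ) (hb : ¬ (3 : ℤ) ∣ b)
    (h : w = y * ((a : ℚ) / (b : ℚ))) : w ∈ O3 := by
  rw [h]; exact O3.mul_mem hy (O3_div a b hb)

lemma ne_of_nd {b : ℤ} (hb : ¬ (3 : ℤ) ∣ b) : (b : ℚ) ≠ 0 := by
  intro h
  have : b = 0 := by exact_mod_cast h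
  exact hb (by simp [this])

def Q (a : ℚ) (k : ℕ) : ℚ := V a k * ((2 * k + 1) * (4 * k + 1 + 4 * a) / (4 * k + 3))

section steps
variable (L m : ℕ) (e : ℚ)

lemma st2 (hx : e * V (3 * L) m ∈ O3) : e * V (27 * L) (9 * m + 2) ∈ O3 := by
  obtain ⟨z, hz, hv⟩ := zlem L m
  have := O3.mul_mem (hz.mem (O3.pow_mem (O3_ofNat 7) (m + 1))) hx
  rw [hv]; convert this using 1; ring

lemma st1 (hx : e * V (3 * L) m ∈ O3) : 3 * e * V (27 * L) (9 * m + 1) ∈ O3 := by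
  have hb : ¬ (3 : ℤ) ∣ (6*m+1)*(36*m+5+108*L)*(9*m+2-27*L) := by
    refine nd_mul (nd_mul ?_ ?_) ?_ <;> omega
  have hb0 := ne_of_nd hb
  refine mulfrac (st2 L m e hx) ((36*m+7)*(18*m+4)*(9*m+2)) ((6*m+1)*(36*m+5+108*L)*(9*m+2-27*L)) hb ?_
  rw [V_succ _ (9 * m + 1), mul_div_assoc', eq_div_iff hb0]
  unfold rho
  push_cast
  field_simp
  ring

lemma st0 (hx : e * V (3 * L) m ∈ O3) : e * V (27 * L) (9 * m) ∈ O3 := by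
  have hb : ¬ (3 : ℤ) ∣ (18*m+1)*(36*m+1+108*L)*(9*m+1-27*L) := by
    refine nd_mul (nd_mul ?_ ?_) ?_ <;> omega
  have hb0 := ne_of_nd hb
  refine mulfrac (st1 L m e hx) ((12*m+1)*(18*m+2)*(9*m+1)) ((18*m+1)*(36*m+1+108*L)*(9*m+1-27*L)) hb ?_
  rw [V_succ _ (9 * m), mul_div_assoc', eq_div_iff hb0]
  unfold rho
  push_cast
  field_simp
  ring

lemma st3 (hx : e * V (3 * L) m ∈ O3) :
    e * V (27 * L) (9 * m + 3) / (3 * (4 * m + 1 + 12 * L)) ∈ O3 := by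
  refine mulfrac (st2 L m e hx) ((18*m+5)*(3*m+1-9*L)) ((36*m+11)*(6*m+2)*(3*m+1)) ?_ ?_
  · refine nd_mul (nd_mul ?_ ?_) ?_ <;> omega
  rw [V_succ _ (9 * m + 2)]
  unfold rho
  push_cast
  field_simp
  ring

lemma st4 (hx : e * V (3 * L) m ∈ O3) :
    e * V (27 * L) (9 * m + 4) / (4 * m + 1 + 12 * L) ∈ O3 := by
  refine mulfrac (st3 L m e hx) ((18*m+7)*(36*m+13+108*L)*(9*m+4-27*L)) ((12*m+5)*(18*m+8)*(9*m+4)) ?_ ?_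
  · refine nd_mul (nd_mul ?_ ?_) ?_ <;> omega
  rw [V_succ _ (9 * m + 3)]
  unfold rho
  push_cast
  field_simp
  ring

lemma st5 (hx : e * V (3 * L) m ∈ O3) :
    e * V (27 * L) (9 * m + 5) / (9 * (2 * m + 1) * (4 * m + 1 + 12 * L)) ∈ O3 := by
  refine mulfrac (st4 L m e hx) ((36*m+17+108*L)*(9*m+5-27*L)) ((36*m+19)*(18*m+10)*(9*m+5)) ?_ ?_
  · refine nd_mul (nd_mul ?_ ?_) ?_ <;> omega
  rw [V_succ _ (9 * m + 4)]
  unfold rho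
  push_cast
  field_simp
  ring

lemma st6 (hx : e * V (3 * L) m ∈ O3) :
    e * V (27 * L) (9 * m + 6) / (9 * (2 * m + 1) * (4 * m + 1 + 12 * L)) ∈ O3 := by
  refine mulfrac (st5 L m e hx) ((18*m+11)*(12*m+7+36*L)*(3*m+2-9*L)) ((36*m+23)*(6*m+4)*(3*m+2)) ?_ ?_
  · refine nd_mul (nd_mul ?_ ?_) ?_ <;> omega
  rw [V_succ _ (9 * m + 5)]
  unfold rho
  push_cast
  field_simp
  ring

/-- from `st6` with `e` replaced by `e * (2m+1)(4m+1+12L)/(4m+3)` when `V ≠ 0` is not needed -/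
lemma V6 : ∃ c ∈ O3, V (27 * L) (9 * m + 6) = 9 * (4 * m + 3) * c * Q (3 * L) m := by
  by_cases h : V (3 * L) m = 0
  · refine ⟨0, O3.zero_mem, ?_⟩
    have : V (27 * L) (9 * m + 2) = 0 := by
      obtain ⟨z, hz, hv⟩ := zlem L m
      rw [hv, h, mul_zero]
    have e : 9 * m + 6 = 9 * m + 2 + 1 + 1 + 1 + 1 := by ring
    rw [e, V_succ _ (9 * m + 2 + 1 + 1 + 1), V_succ _ (9 * m + 2 + 1 + 1), V_succ _ (9 * m + 2 + 1),
      V_succ _ (9 * m + 2), this]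
    simp
  · refine ⟨_, st6 L m (V (3 * L) m)⁻¹ (by rw [inv_mul_cancel₀ h]; exact O3.one_mem), ?_⟩
    unfold Q
    have h1 : 4 * (m : ℚ) + 1 + 4 * (3 * L) ≠ 0 := by positivity
    have h2 : 4 * (m : ℚ) + 1 + 12 * L ≠ 0 := by positivity
    generalize V (3 * (L:ℚ)) m = x at h ⊢
    field_simp
    ring

lemma st6' (hq : e * Q (3 * L) m ∈ O3) :
    e * V (27 * L) (9 * m + 6) / (9 * (4 * m + 3)) ∈ O3 := by
  obtain ⟨c, hc, h⟩ := V6 L m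
  have := O3.mul_mem hc hq
  rw [h]
  convert this using 1
  field_simp

lemma st7 (hq : e * Q (3 * L) m ∈ O3) : e * V (27 * L) (9 * m + 7) ∈ O3 := by
  refine mulfrac (st6' L m e hq) ((18*m+13)*(36*m+25+108*L)*(9*m+7-27*L)) ((18*m+14)*(9*m+7)) ?_ ?_
  · refine nd_mul ?_ ?_ <;> omega
  rw [V_succ _ (9 * m + 6)]
  unfold rho
  push_cast
  field_simp
  ring

lemma st8 (hq : e * Q (3 * L) m ∈ O3) : e * V (27 * L) (9 * m + 8) / 3 ∈ O3 := by
  refine mulfrac (st7 L m e hq) ((6*m+5)*(36*m+29+108*L)*(9*m+8-27*L)) ((36*m+31)*(18*m+16)*(9*m+8)) ?_ ?_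
  · refine nd_mul (nd_mul ?_ ?_) ?_ <;> omega
  rw [V_succ _ (9 * m + 7)]
  unfold rho
  push_cast
  field_simp
  ring

lemma K3 (hx : e * V (3 * L) m ∈ O3) (hq : e * Q (3 * L) m ∈ O3) (s : ℕ) (hs : s < 9) (h2 : s ≠ 2) :
    3 * e * (V (27 * L) (9 * m + s) / (4 * (9 * m + s : ℕ) + 1)) ∈ O3 := by
  interval_cases s
  · refine mulfrac (st0 L m e hx) 3 (36*m+1) (by omega) ?_
    push_cast; rw [add_zero]; field_simp; ring
  · refine mulfrac (st1 L m e hx) 1 (36*m+5) (by omega) ?_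
    push_cast; field_simp; ring
  · omega
  · refine mulfrac (st3 L m e hx) (9 * (4 * m + 1 + 12 * L)) (36*m+13) (by omega) ?_
    push_cast; field_simp; ring
  · refine mulfrac (st4 L m e hx) (3 * (4 * m + 1 + 12 * L)) (36*m+17) (by omega) ?_
    push_cast; field_simp; ring
  · refine mulfrac (st5 L m e hx) (9 * (2 * m + 1) * (4 * m + 1 + 12 * L)) (12*m+7) (by omega) ?_
    push_cast; field_simp; ring
  · refine mulfrac (st6 L m e hx) (27 * (2 * m + 1) * (4 * m + 1 + 12 * L)) (36*m+25) (by omega) ?_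
    push_cast; field_simp; ring
  · refine mulfrac (st7 L m e hq) 3 (36*m+29) (by omega) ?_
    push_cast; field_simp; ring
  · refine mulfrac (st8 L m e hq) 3 (12*m+11) (by omega) ?_
    push_cast; field_simp; ring

lemma K1 (hx : e * V (3 * L) m ∈ O3) (hq : e * Q (3 * L) m ∈ O3) (s : ℕ) (hs : s < 9) :
    3 * e * V (27 * L) (9 * m + s) ∈ O3 := by
  by_cases h2 : s = 2
  · subst h2
    rw [mul_assoc]
    exact O3.mul_mem (O3_ofNat 3) (st2 L m e hx)
  · refine mulfrac (K3 L m e hx hq s hs h2) (4 * (9 * m + s : ℕ) + 1) 1 (by norm_num) ?_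
    push_cast; field_simp

lemma K2 (hx : e * V (3 * L) m ∈ O3) (hq : e * Q (3 * L) m ∈ O3) (s : ℕ) (hs : s < 9) :
    3 * e * Q (27 * L) (9 * m + s) ∈ O3 := by
  unfold Q
  interval_cases s
  · refine mulfrac (st0 L m e hx) ((18*m+1)*(36*m+1+108*L)) (12*m+1) (by omega) ?_
    push_cast; rw [add_zero]; field_simp; ring
  · refine mulfrac (st1 L m e hx) ((18*m+3)*(36*m+5+108*L)) (36*m+7) (by omega) ?_
    push_cast; field_simp; ring
  · refine mulfrac (st2 L m e hx) (3*(18*m+5)*(36*m+9+108*L)) (36*m+11) (by omega) ?_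
    push_cast; field_simp; ring
  · refine mulfrac (st3 L m e hx) (3*(4 * m + 1 + 12 * L)*(18*m+7)*(36*m+13+108*L)) (12*m+5) (by omega) ?_
    push_cast; field_simp; ring
  · refine mulfrac (st4 L m e hx) (3 * (4 * m + 1 + 12 * L)*(18*m+9)*(36*m+17+108*L)) (36*m+19) (by omega) ?_
    push_cast; field_simp; ring
  · refine mulfrac (st5 L m e hx) (27 * (2 * m + 1) * (4 * m + 1 + 12 * L)*(18*m+11)*(36*m+21+108*L)) (36*m+23) (by omega) ?_
    push_cast; field_simp; ring
  · refine mulfrac (st6' L m e hq) (3 *(18*m+13)*(36*m+25+108*L)) 1 (by norm_num) ?_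
    push_cast; field_simp; ring
  · refine mulfrac (st7 L m e hq) (3 *(18*m+15)*(36*m+29+108*L)) (36*m+31) (by omega) ?_
    push_cast; field_simp; ring
  · refine mulfrac (st8 L m e hq) (9 *(18*m+17)*(36*m+33+108*L)) (36*m+35) (by omega) ?_
    push_cast; field_simp; ring

end steps

lemma B (t : ℕ) : ∀ k < 3 * 9 ^ t, (3 : ℚ) ^ (t + 1) * V (3 * (9 ^ t : ℕ)) k ∈ O3 ∧
    (3 : ℚ) ^ (t + 1) * Q (3 * (9 ^ t : ℕ)) k ∈ O3 := by
  induction t with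
  | zero =>
    intro k hk
    have h0 : V 3 0 = 1 := by simp [V, U_zero]
    have h1 : V 3 1 = -13/3 := by rw [V_succ, h0]; norm_num [rho]
    have h2 : V 3 2 = 221/56 := by rw [V_succ, h1]; norm_num [rho]
    have hk : k < 3 := by simpa using hk
    unfold Q
    interval_cases k
    · exact ⟨mulfrac O3.one_mem 3 1 (by norm_num) (by norm_num [h0]),
        mulfrac O3.one_mem 13 1 (by norm_num) (by norm_num [h0])⟩
    · exact ⟨mulfrac O3.one_mem (-13) 1 (by norm_num) (by norm_num [h1]),
        mulfrac O3.one_mem (-663) 7 (by norm_num) (by norm_num [h1])⟩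
    · exact ⟨mulfrac O3.one_mem 663 56 (by norm_num) (by norm_num [h2]),
        mulfrac O3.one_mem 9945 88 (by norm_num) (by norm_num [h2])⟩
  | succ t ih =>
    intro k hk
    obtain ⟨hx, hq⟩ := ih (k / 9) (by rw [pow_succ] at hk; omega)
    have a := K1 (9 ^ t) (k / 9) _ hx hq (k % 9) (Nat.mod_lt _ (by norm_num))
    have b := K2 (9 ^ t) (k / 9) _ hx hq (k % 9) (Nat.mod_lt _ (by norm_num))
    rw [Nat.div_add_mod] at a b
    have e : (3 * (9 ^ (t + 1) : ℕ) : ℚ) = 27 * (9 ^ t : ℕ) := by push_cast; ring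
    rw [e, pow_succ' (3 : ℚ) (t + 1)]
    exact ⟨a, b⟩

lemma sum9 (f : ℕ → ℚ) (n : ℕ) : ∑ k ∈ range (9 * n), f k =
    ∑ m ∈ range n, ∑ s ∈ range 9, f (9 * m + s) := by
  induction n with
  | zero => simp
  | succ n ih => rw [sum_range_succ, ← ih, mul_add, mul_one, sum_range_add]

lemma C9_sum (f g : ℕ → ℚ) (n : ℕ) (h : ∀ k < n, C9 (f k) (g k)) :
    C9 (∑ k ∈ range n, f k) (∑ k ∈ range n, g k) := by
  induction n with
  | zero => simpa using C9.refl 0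
  | succ n ih =>
    rw [sum_range_succ, sum_range_succ]
    exact (ih fun k hk => h k (by omega)).add (h n (by omega))

def Y (t k : ℕ) : ℚ := 3 ^ (2 * t + 2) * (V (3 * (9 ^ t : ℕ)) k / (4 * k + 1))

lemma seven (k : ℕ) : ((7 : ℚ) ^ (9 * k + 2 + 1) - 1) / 9 ∈ O3 := by
  have h : (9 : ℤ) ∣ 7 ^ (9 * k + 2 + 1) - 1 := by
    apply nine_dvd
    push_cast
    have : (7 : ZMod 9) ^ (9 * k + 2 + 1) = ((7 : ZMod 9) ^ 3) ^ (3 * k + 1) := by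
      rw [← pow_mul]; congr 1; ring
    rw [this, show (7 : ZMod 9) ^ 3 = 1 from rfl]
    simp
  obtain ⟨c, hc⟩ := h
  have : ((7 : ℚ) ^ (9 * k + 2 + 1) - 1) = 9 * c := by exact_mod_cast hc
  rw [this]
  convert O3_int c using 1
  ring

/-- for `s ≠ 2` the terms vanish mod 9 -/
lemma Y_other (t m s : ℕ) (hm : m < 3 * 9 ^ t) (hs : s < 9) (h2 : s ≠ 2) :
    Y (t + 1) (9 * m + s) / 9 ∈ O3 := by
  obtain ⟨hx, hq⟩ := B t m hm
  have a := O3.mul_mem (O3.pow_mem (O3_ofNat 3) t) (K3 (9 ^ t) m _ hx hq s hs h2)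
  convert a using 1
  unfold Y
  have e : (3 * (9 ^ (t + 1) : ℕ) : ℚ) = 27 * (9 ^ t : ℕ) := by push_cast; ring
  rw [e]
  have e2 : (3 : ℚ) ^ (2 * (t + 1) + 2) = 9 * (3 ^ t * (3 * 3 ^ (t + 1))) := by
    ring
  rw [e2]
  ring

lemma Y_two (t m : ℕ) : ∃ z, C9 z (7 ^ (m + 1)) ∧ Y (t + 1) (9 * m + 2) = z * Y t m := by
  obtain ⟨z, hz, h⟩ := zlem (9 ^ t) m
  refine ⟨z, hz, ?_⟩
  unfold Y
  have e : (3 * (9 ^ (t + 1) : ℕ) : ℚ) = 27 * (9 ^ t : ℕ) := by push_cast; ring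
  rw [e, h]
  push_cast
  generalize V (3 * 9 ^ t) m = v
  have e1 : 4 * (9 * (m : ℚ) + 2) + 1 = 9 * (4 * m + 1) := by ring
  have e2 : (3 : ℚ) ^ (2 * (t + 1) + 2) = 9 * 3 ^ (2 * t + 2) := by ring
  rw [e1, e2]
  field_simp

lemma P (t : ℕ) : (∀ k < 3 * 9 ^ t, Y t k ∈ O3 ∧ C9 (7 ^ (k + 1) * Y t k) (Y t k)) ∧
    C9 (∑ k ∈ range (3 * 9 ^ t), Y t k) 1 := by
  induction t with
  | zero =>
    have h0 : V 3 0 = 1 := by simp [V, U_zero]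
    have h1 : V 3 1 = -13/3 := by rw [V_succ, h0]; norm_num [rho]
    have h2 : V 3 2 = 221/56 := by rw [V_succ, h1]; norm_num [rho]
    have y0 : Y 0 0 = 9 := by norm_num [Y, h0]
    have y1 : Y 0 1 = -39/5 := by norm_num [Y, h1]
    have y2 : Y 0 2 = 221/56 := by norm_num [Y, h2]
    constructor
    · intro k hk
      have hk : k < 3 := by simpa using hk
      unfold C9
      interval_cases k
      · rw [y0]
        exact ⟨O3_ofNat 9, mulfrac O3.one_mem 6 1 (by norm_num) (by norm_num)⟩
      · rw [y1]
        exact ⟨mulfrac O3.one_mem (-39) 5 (by norm_num) (by norm_num),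
          mulfrac O3.one_mem (-208) 5 (by norm_num) (by norm_num)⟩
      · rw [y2]
        exact ⟨mulfrac O3.one_mem 221 56 (by norm_num) (by norm_num),
          mulfrac O3.one_mem (221*38) 56 (by norm_num) (by norm_num)⟩
    · norm_num [sum_range_succ, y0, y1, y2, C9]
      exact mulfrac O3.one_mem 129 280 (by norm_num) (by norm_num)
  | succ t ih =>
    obtain ⟨ih1, ih2⟩ := ih
    have two : ∀ m < 3 * 9 ^ t, C9 (Y (t + 1) (9 * m + 2)) (Y t m) := by
      intro m hm
      obtain ⟨z, hz, h⟩ := Y_two t m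
      obtain ⟨a, b⟩ := ih1 m hm
      rw [h]
      exact (hz.mul (C9.refl _) a (O3.pow_mem (O3_ofNat 7) _)).trans b
    constructor
    · intro k hk
      have hm : k / 9 < 3 * 9 ^ t := by rw [pow_succ] at hk; omega
      have hs : k % 9 < 9 := Nat.mod_lt _ (by norm_num)
      rw [← Nat.div_add_mod k 9]
      generalize k / 9 = m at *
      generalize k % 9 = s at *
      by_cases h2 : s = 2
      · subst h2
        have y := (two m hm).mem (ih1 m hm).1
        refine ⟨y, ?_⟩
        have := O3.mul_mem (seven m) y
        unfold C9
        convert this using 1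
        ring
      · have y := Y_other t m s hm hs h2
        constructor
        · have := O3.mul_mem (O3_ofNat 9) y
          convert this using 1
          ring
        · have := O3.mul_mem (O3.sub_mem (O3.pow_mem (O3_ofNat 7) (9 * m + s + 1)) O3.one_mem) y
          unfold C9
          convert this using 1
          ring
    · have e : 3 * 9 ^ (t + 1) = 9 * (3 * 9 ^ t) := by ring
      rw [e, sum9]
      refine C9.trans (C9_sum _ (Y t) _ ?_) ih2
      intro m hm
      have o : ∀ s, s < 9 → s ≠ 2 → C9 (Y (t + 1) (9 * m + s)) 0 := by
        intro s hs h2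
        have := Y_other t m s hm hs h2
        unfold C9; rwa [sub_zero]
      simp only [sum_range_succ, sum_range_zero]
      have := (((((((((C9.refl 0).add (o 0 (by omega) (by omega))).add (o 1 (by omega) (by omega))).add
        (two m hm)).add (o 3 (by omega) (by omega))).add (o 4 (by omega) (by omega))).add
        (o 5 (by omega) (by omega))).add (o 6 (by omega) (by omega))).add
        (o 7 (by omega) (by omega))).add (o 8 (by omega) (by omega))
      simpa using this

lemma A_final (t : ℕ) : ∃ z, C9 z 1 ∧ 16 * A (3 * 9 ^ t) ^ 2 = 9 * z := by
  have h : ∃ z, C9 z 1 ∧ A (3 * 9 ^ t) = A 3 * z := by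
    induction t with
    | zero => exact ⟨1, C9.refl 1, by simp⟩
    | succ t ih =>
      obtain ⟨z, hz, h⟩ := ih
      obtain ⟨z', hz', h'⟩ := Astep (3 * 9 ^ t)
      refine ⟨z * z', by simpa using hz.mul hz' (hz'.mem O3.one_mem) O3.one_mem, ?_⟩
      have e : 3 * 9 ^ (t + 1) = 9 * (3 * 9 ^ t) := by ring
      rw [e, h', h, mul_assoc]
  obtain ⟨z, hz, h⟩ := h
  have hA : A 3 = 15 / 128 := by norm_num [A, prod_range_succ]
  have hc := C9_div 25 1024 1 (by norm_num) (by norm_num)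
  have hm := hz.mem O3.one_mem
  have hzz := hz.mul hz hm O3.one_mem
  refine ⟨_, by simpa using hc.mul hzz (O3.mul_mem hm hm) (by simpa using O3.one_mem), ?_⟩
  rw [h, hA]
  push_cast
  ring

theorem stmt19 (r : ℕ) (hr : 1 ≤ r) (hrodd : Odd r) :
    ratCongr 3 ((r : ℤ) + 3)
      (∑ k ∈ Finset.range (3 ^ r),
        (8 * (k : ℚ) + 1) * poch (1/4) k ^ 3 * poch (1/2) k /
          (poch 1 k ^ 3 * poch (3/4) k))
      ((3 : ℚ) ^ (r + 1)) := by
  obtain ⟨t, rfl⟩ := hrodd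
  have e : 3 ^ (2 * t + 1) = 3 * 9 ^ t := by rw [pow_succ, pow_mul]; norm_num; ring
  rw [e]
  simp only [term_eq]
  rw [whipple_s19]
  obtain ⟨z, hz, hA⟩ := A_final t
  obtain ⟨-, hP⟩ := P t
  have hPm := hP.mem O3.one_mem
  have h := hz.mul hP hPm O3.one_mem
  have hY : ∑ k ∈ range (3 * 9 ^ t), Y t k = 3 ^ (2 * t + 2) *
      ∑ j ∈ range (3 * 9 ^ t), U ((3 * 9 ^ t : ℕ) : ℚ) ((3 * 9 ^ t : ℕ) - 1) j / (4 * j + 1) := by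
    rw [mul_sum]
    refine sum_congr rfl fun j _ => ?_
    unfold Y V
    push_cast
    rfl
  rw [hY] at h
  generalize ∑ j ∈ range (3 * 9 ^ t), U ((3 * 9 ^ t : ℕ) : ℚ) ((3 * 9 ^ t : ℕ) - 1) j / (4 * j + 1) = X at *
  unfold C9 at h
  set o := (z * (3 ^ (2 * t + 2) * X) - 1 * 1) / 9 with ho
  have key : 16 * ((3 * 9 ^ t : ℕ) : ℚ) ^ 2 * A (3 * 9 ^ t) ^ 2 * X - 3 ^ (2 * t + 1 + 1) =
      3 ^ (2 * t + 1 + 3) * o := by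
    have e1 : 16 * ((3 * 9 ^ t : ℕ) : ℚ) ^ 2 * A (3 * 9 ^ t) ^ 2 * X =
      ((3 * 9 ^ t : ℕ) : ℚ) ^ 2 * (16 * A (3 * 9 ^ t) ^ 2) * X := by ring
    rw [e1, hA, ← e, ho]
    push_cast
    ring
  unfold ratCongr
  by_cases h0 : o = 0
  · left
    rw [h0, mul_zero] at key
    linarith
  · right
    have hv : 0 ≤ padicValRat 3 o := h
    rw [key, padicValRat.mul (by positivity) h0, padicValRat.pow (3 : ℚ)]
    have : padicValRat 3 (3 : ℚ) = 1 := by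
      exact_mod_cast padicValRat.self (p := 3) (by norm_num)
    rw [this]
    push_cast
    linarith
end
end
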